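/- arXiv:1010.5235 — 6 statements merged into one kernel-verified Lean document; each statement's English description precedes it below -/
import Mathlib

section
/- For every 4-special polygon P with angle parameters φ = φ(P) and α = α(P), the following inequalities hold: (1) 0 < φ < 2π/3; (2) 0 < α < π/2; (3) φ − π/6 < α < φ + π/3. -/
open Real EuclideanGeometry

attribute [local instance] Complex.finrank_real_complex_fact

/-- The signed turning angle at the middle vertex `q` of the path `p → q → r`:
the oriented angle from the direction `q - p` to the direction `r - q`,
taken in `(-π, π]`. -/
noncomputable def turn (p q r : ℂ) : ℝ :=
  (Complex.orientation.oangle (q - p) (r - q)).toReal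

/-- A cyclic sequence of vertices in the plane bounds a simple polygon:
all edges are nondegenerate, consecutive edges meet exactly in their shared
vertex, and non-adjacent edges are disjoint. -/
def IsSimplePolygon {n : ℕ} [NeZero n] (v : Fin n → ℂ) : Prop :=
  (∀ i, v i ≠ v (i + 1)) ∧
  (∀ i : Fin n, segment ℝ (v i) (v (i + 1)) ∩ segment ℝ (v (i + 1)) (v (i + 2)) = {v (i + 1)}) ∧
  (∀ i j : Fin n, j ≠ i → j ≠ i + 1 → j + 1 ≠ i →
    segment ℝ (v i) (v (i + 1)) ∩ segment ℝ (v j) (v (j + 1)) = ∅)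

/-- A simple polygon is positively (counterclockwisely) oriented when the sum
of its signed turning angles is `2π`. -/
def IsCCW {n : ℕ} [NeZero n] (v : Fin n → ℂ) : Prop :=
  ∑ i : Fin n, turn (v (i - 1)) (v i) (v (i + 1)) = 2 * π

/-- The interior angle of a counterclockwisely ordered simple polygon at its
`i`-th vertex: `π` minus the signed turning angle there.  It may exceed `π`
(at reflex vertices). -/
noncomputable def intAngle {n : ℕ} [NeZero n] (v : Fin n → ℂ) (i : Fin n) : ℝ :=
  π - turn (v (i - 1)) (v i) (v (i + 1))

/-- A 2-special polygon: a simple quadrilateral with counterclockwise vertices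
`a, c', d, c''` whose interior angle at `a` is `4π/3`, whose interior angles at
`c'` and `c''` are less than `π`, whose interior angle at `d` is `π/3`, and with
`c'`, `d`, `c''` equidistant from `a`. -/
def Is2Special (a c' d c'' : ℂ) : Prop :=
  IsSimplePolygon ![a, c', d, c''] ∧ IsCCW ![a, c', d, c''] ∧
  intAngle ![a, c', d, c''] 0 = 4 * π / 3 ∧
  intAngle ![a, c', d, c''] 1 < π ∧
  intAngle ![a, c', d, c''] 3 < π ∧
  intAngle ![a, c', d, c''] 2 = π / 3 ∧
  dist a c' = dist a d ∧ dist a d = dist a c''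

/-- A 3-special polygon: a simple pentagon with counterclockwise vertices
`a, c', e', e'', c''` whose interior angle at `a` is `4π/3`, all other interior
angles being less than `π`, with interior angles `π/3` at `c'` and `c''`,
`dist a c' = dist a c''`, sides `c'e'` and `c''e''` parallel and of equal
length, and interior angles `π/2` at `e'` and `e''`. -/
def Is3Special (a c' e' e'' c'' : ℂ) : Prop :=
  IsSimplePolygon ![a, c', e', e'', c''] ∧ IsCCW ![a, c', e', e'', c''] ∧
  intAngle ![a, c', e', e'', c''] 0 = 4 * π / 3 ∧
  (∀ i : Fin 5, i ≠ 0 → intAngle ![a, c', e', e'', c''] i < π) ∧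
  intAngle ![a, c', e', e'', c''] 1 = π / 3 ∧
  intAngle ![a, c', e', e'', c''] 4 = π / 3 ∧
  dist a c' = dist a c'' ∧
  (∃ r : ℝ, e'' - c'' = r • (e' - c')) ∧
  dist c' e' = dist c'' e'' ∧
  intAngle ![a, c', e', e'', c''] 2 = π / 2 ∧
  intAngle ![a, c', e', e'', c''] 3 = π / 2

/-- A 4-special polygon: a simple hexagon with counterclockwise vertices
`a, c', e', f', e'', c''` whose interior angle at `a` is `4π/3`, all other
interior angles being less than `π`, with interior angles `π/3` at `c'` and
`c''`, `dist a c' = dist a c''`, sides `c'e'` and `c''e''` parallel and of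
equal length, and `e'`, `f'`, `e''` equidistant from `a`. -/
def Is4Special (a c' e' f' e'' c'' : ℂ) : Prop :=
  IsSimplePolygon ![a, c', e', f', e'', c''] ∧ IsCCW ![a, c', e', f', e'', c''] ∧
  intAngle ![a, c', e', f', e'', c''] 0 = 4 * π / 3 ∧
  (∀ i : Fin 6, i ≠ 0 → intAngle ![a, c', e', f', e'', c''] i < π) ∧
  intAngle ![a, c', e', f', e'', c''] 1 = π / 3 ∧
  intAngle ![a, c', e', f', e'', c''] 5 = π / 3 ∧
  dist a c' = dist a c'' ∧
  (∃ r : ℝ, e'' - c'' = r • (e' - c')) ∧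
  dist c' e' = dist c'' e'' ∧
  dist a e' = dist a f' ∧ dist a f' = dist a e''

theorem turn_eq (p q r : ℂ) : turn p q r = Complex.arg ((starRingEnd ℂ) (q-p) * (r-q)) := by
  unfold turn
  rw [Complex.oangle, Complex.arg_coe_angle_toReal_eq_arg]

theorem im_pos_of_arg {z : ℂ} (h0 : 0 < z.arg) (h1 : z.arg < π) : 0 < z.im := by
  have hz : z ≠ 0 := by rintro rfl; simp at h0
  rw [← Complex.norm_mul_sin_arg]
  exact mul_pos (norm_pos_iff.2 hz) (Real.sin_pos_of_pos_of_lt_pi h0 h1)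

theorem exists_of_arg {p q : ℂ} {η : ℝ} (h : Complex.arg ((starRingEnd ℂ) p * q) = η) (hη : η ≠ 0) :
    p ≠ 0 ∧ ∃ r : ℝ, 0 < r ∧ q = r * p * (Real.cos η + Real.sin η * Complex.I) := by
  have hp : p ≠ 0 := by rintro rfl; simp at h; exact hη h.symm
  have hq : q ≠ 0 := by rintro rfl; simp at h; exact hη h.symm
  refine ⟨hp, ‖q‖ / ‖p‖, by positivity, ?_⟩
  have h1 := Complex.norm_mul_cos_add_sin_mul_I ((starRingEnd ℂ) p * q)
  rw [h] at h1
  have hc : (starRingEnd ℂ) p ≠ 0 := by simpa using hp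
  apply mul_left_cancel₀ hc
  rw [← h1]
  have : (starRingEnd ℂ) p * p = (‖p‖:ℂ)^2 := by
    rw [Complex.conj_mul']
  have hn : (‖p‖:ℂ) ≠ 0 := by simpa using hp
  push_cast
  simp only [norm_mul, RCLike.norm_conj]
  push_cast
  field_simp
  linear_combination (-(↑‖q‖ * (Complex.cos η + Complex.sin η * Complex.I))) * this

theorem arg_div_polar {ρ σ x y : ℝ} (hρ : 0 < ρ) (hσ : 0 < σ) (h : x - y ∈ Set.Ioc (-π) π) :
    Complex.arg ((ρ * (Complex.cos x + Complex.sin x * Complex.I)) / (σ * (Complex.cos y + Complex.sin y * Complex.I))) = x - y := by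
  have : (ρ * (Complex.cos x + Complex.sin x * Complex.I)) / (σ * (Complex.cos y + Complex.sin y * Complex.I)) = ((ρ / σ : ℝ) : ℂ) * (Complex.cos (x - y : ℝ) + Complex.sin (x - y : ℝ) * Complex.I) := by
    rw [← Complex.exp_mul_I, ← Complex.exp_mul_I, ← Complex.exp_mul_I]
    push_cast
    rw [sub_mul, Complex.exp_sub]
    have := Complex.exp_ne_zero (y * Complex.I)
    have hs : (σ : ℂ) ≠ 0 := by exact_mod_cast hσ.ne'
    field_simp
  rw [this, Complex.arg_mul_cos_add_sin_mul_I (by positivity) h]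

/-- the trigonometric core in normalised coordinates -/
theorem core {t : ℝ} (ht : 0 < t) {g : ℂ} {h : ℝ} (hh : h = √3 / 2)
    (hg : ‖g‖ = ‖(⟨t - 1/2, -h⟩ : ℂ)‖) (h1 : -h < g.im) (h2 : g.im < h) (h3 : t - 1/2 < g.re) :
    ∃ φ ψ : ℝ, Complex.arg ((⟨-1/2, -h⟩ : ℂ) / ⟨t - 1/2, -h⟩) = -φ ∧
      Complex.arg (g / ⟨t - 1/2, -h⟩) = ψ ∧ 0 < φ ∧ φ < 2 * π / 3 ∧ 0 < ψ ∧ ψ < π ∧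
      φ - π / 6 < (π - ψ) / 2 ∧ (π - ψ) / 2 < φ + π / 3 := by
  have hπ := Real.pi_pos
  have hhp : 0 < h := by rw [hh]; positivity
  set z : ℂ := ⟨t - 1/2, -h⟩ with hz
  have hz0 : z ≠ 0 := by
    intro h0; have := congrArg Complex.im h0; simp [hz] at this; linarith
  have hρ : 0 < ‖z‖ := norm_pos_iff.2 hz0
  set ρ := ‖z‖ with hρd
  obtain ⟨θ₀, hθ₀⟩ : ∃ x, x = - z.arg := ⟨_, rfl⟩
  have hzc : ρ * cos θ₀ = t - 1/2 := by
    rw [hθ₀, Real.cos_neg, hρd, Complex.norm_mul_cos_arg]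
  have hzs : ρ * sin θ₀ = h := by
    rw [hθ₀, Real.sin_neg, mul_neg, hρd, Complex.norm_mul_sin_arg]; simp [hz]
  have hθpos : 0 < θ₀ := by
    have : z.arg < 0 := Complex.arg_neg_iff.2 (by simp [hz]; exact hhp)
    linarith
  have hθpi : θ₀ < π := by linarith [Complex.neg_pi_lt_arg z]
  have hgc : ρ * cos g.arg = g.re := by rw [← hg, Complex.norm_mul_cos_arg]
  have hgs : ρ * sin g.arg = g.im := by rw [← hg, Complex.norm_mul_sin_arg]
  have hsq : g.re ^ 2 + g.im ^ 2 = (t - 1/2)^2 + h^2 := by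
    rw [← hgc, ← hgs, ← hzc, ← hzs]
    linear_combination ρ^2 * Real.sin_sq_add_cos_sq g.arg - ρ^2 * Real.sin_sq_add_cos_sq θ₀
  have h4 : -(t-1/2) < g.re := by
    by_contra hcon
    nlinarith
  set θ := g.arg with hθ
  have hab : cos |θ| = cos θ := Real.cos_abs θ
  have hle : |θ| ≤ π := Complex.abs_arg_le_pi g
  have hA : |θ| < θ₀ := by
    by_contra hcon
    push Not at hcon
    have := Real.cos_le_cos_of_nonneg_of_le_pi hθpos.le hle hcon
    nlinarith
  have hB : |θ| < π - θ₀ := by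
    by_contra hcon
    push Not at hcon
    have := Real.cos_le_cos_of_nonneg_of_le_pi (by linarith) hle hcon
    rw [Real.cos_pi_sub] at this
    nlinarith
  have hC : θ₀ < 2 * π / 3 := by
    by_contra hcon
    push Not at hcon
    have := Real.sin_nonneg_of_nonneg_of_le_pi (x := θ₀ - 2 * π / 3) (by linarith) (by linarith)
    have e : 2 * π / 3 = π - π / 3 := by ring
    rw [Real.sin_sub, e, Real.cos_pi_sub, Real.sin_pi_sub, Real.cos_pi_div_three, Real.sin_pi_div_three, ← hh] at this
    nlinarith
  rw [abs_lt] at hA hB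
  have ez : z = ρ * (Complex.cos (-θ₀ : ℝ) + Complex.sin (-θ₀ : ℝ) * Complex.I) := by
    rw [hθ₀, neg_neg, Complex.norm_mul_cos_add_sin_mul_I]
  have eg : g = ρ * (Complex.cos θ + Complex.sin θ * Complex.I) := by
    rw [← hg, Complex.norm_mul_cos_add_sin_mul_I]
  have ew : (⟨-1/2, -h⟩ : ℂ) = (1:ℝ) * (Complex.cos (-(2 * π / 3) : ℝ) + Complex.sin (-(2 * π / 3) : ℝ) * Complex.I) := by
    have e : 2 * π / 3 = π - π / 3 := by ring
    rw [← Complex.ofReal_cos, ← Complex.ofReal_sin, Real.cos_neg, Real.sin_neg, e, Real.cos_pi_sub, Real.sin_pi_sub, Real.cos_pi_div_three, Real.sin_pi_div_three, ← hh]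
    apply Complex.ext <;> simp
    norm_num
  refine ⟨2 * π / 3 - θ₀, θ + θ₀, ?_, ?_, by linarith, by linarith, by linarith, by linarith, by linarith, by linarith⟩
  · rw [ew, ez, arg_div_polar one_pos hρ ⟨by linarith, by linarith⟩]; ring
  · rw [ez]; nth_rw 1 [eg]; rw [arg_div_polar hρ hρ ⟨by linarith, by linarith⟩]; ring

set_option maxHeartbeats 1000000 in
/-- For every 4-special polygon with angle parameters `φ = ∠c'ae'` and
`α = ∠ae'f'` one has `0 < φ < 2π/3`, `0 < α < π/2`, and
`φ − π/6 < α < φ + π/3`. -/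
theorem four_special_angle_parameters (a c' e' f' e'' c'' : ℂ)
    (h : Is4Special a c' e' f' e'' c'')
    (φ α : ℝ) (hφ : φ = EuclideanGeometry.angle c' a e')
    (hα : α = EuclideanGeometry.angle a e' f') :
    (0 < φ ∧ φ < 2 * π / 3) ∧ (0 < α ∧ α < π / 2) ∧
      (φ - π / 6 < α ∧ α < φ + π / 3) := by
  obtain ⟨-, hccw, h0, hlt, h1, h5, hd, -, hde, hdf, hdf2⟩ := h
  have k2 := hlt 2 (by decide)
  have k3 := hlt 3 (by decide)
  have k4 := hlt 4 (by decide)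
  simp only [IsCCW, Fin.sum_univ_six] at hccw
  simp only [intAngle] at h0 h1 h5 k2 k3 k4
  change turn c'' a c' + turn a c' e' + turn c' e' f' + turn e' f' e'' + turn f' e'' c''
    + turn e'' c'' a = 2 * π at hccw
  change π - turn c'' a c' = _ at h0
  change π - turn a c' e' = _ at h1
  change π - turn e'' c'' a = _ at h5
  change π - turn c' e' f' < _ at k2
  change π - turn e' f' e'' < _ at k3
  change π - turn f' e'' c'' < _ at k4
  have hπ := Real.pi_pos
  have j2 : turn c' e' f' < π := by linarith
  have j3 : turn e' f' e'' < π := by linarith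
  have j4 : turn f' e'' c'' < π := by linarith
  replace k2 : 0 < turn c' e' f' := by linarith
  replace k3 : 0 < turn e' f' e'' := by linarith
  replace k4 : 0 < turn f' e'' c'' := by linarith
  replace h0 : turn c'' a c' = -(π / 3) := by linarith
  replace h1 : turn a c' e' = π - π / 3 := by linarith
  replace h5 : turn e'' c'' a = π - π / 3 := by linarith
  rw [turn_eq] at h0 h1 h5 k2 k3 k4 j2 j3 j4
  obtain ⟨n0, r, hr, er⟩ := exists_of_arg h0 (by linarith)
  obtain ⟨n1, t, ht, et⟩ := exists_of_arg h1 (by linarith)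
  obtain ⟨n5, s, hs, es⟩ := exists_of_arg h5 (by linarith)
  have i2 := im_pos_of_arg k2 j2
  have i3 := im_pos_of_arg k3 j3
  have i4 := im_pos_of_arg k4 j4
  obtain ⟨h, hh⟩ : ∃ h : ℝ, h = √3 / 2 := ⟨_, rfl⟩
  have hh2 : h ^ 2 = 3 / 4 := by rw [hh, div_pow, Real.sq_sqrt (by norm_num)]; norm_num
  have hhC : (h : ℂ) ^ 2 = 3 / 4 := by
    rw [← Complex.ofReal_pow, hh2]; norm_num
  have hhp : 0 < h := by rw [hh]; positivity
  rw [Real.cos_neg, Real.sin_neg, Real.cos_pi_div_three, Real.sin_pi_div_three, ← hh] at er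
  rw [Real.cos_pi_sub, Real.sin_pi_sub, Real.cos_pi_div_three, Real.sin_pi_div_three, ← hh] at et es
  push_cast at er et es
  have hI := Complex.I_sq
  have nrm1 : ‖(1 / 2 + -(h : ℂ) * Complex.I)‖ = 1 := by
    rw [← sq_eq_sq₀ (norm_nonneg _) zero_le_one, Complex.sq_norm, Complex.normSq_apply]
    simp; linarith
  have nrm2 : ‖(-(1 / 2) + (h : ℂ) * Complex.I)‖ = 1 := by
    rw [← sq_eq_sq₀ (norm_nonneg _) zero_le_one, Complex.sq_norm, Complex.normSq_apply]
    simp; linarith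
  have r1 : r = 1 := by
    have := congrArg norm er
    rw [norm_mul, norm_mul, nrm1, Complex.norm_real, Real.norm_of_nonneg hr.le, mul_one,
      ← dist_eq_norm, ← dist_eq_norm, dist_comm c' a, hd] at this
    have hp : 0 < dist a c'' := by rw [dist_eq_norm]; exact norm_pos_iff.2 n0
    have : (r - 1) * dist a c'' = 0 := by linarith
    rcases mul_eq_zero.1 this with h | h <;> linarith
  have hcpos : 0 < dist a c'' := by rw [dist_eq_norm]; exact norm_pos_iff.2 n0
  have st : s * t = 1 := by
    have A := congrArg norm et
    have B := congrArg norm es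
    rw [norm_mul, norm_mul, nrm2, Complex.norm_real, Real.norm_of_nonneg ht.le, mul_one,
      ← dist_eq_norm, ← dist_eq_norm, dist_comm c' a, hd, dist_comm, hde] at A
    rw [norm_mul, norm_mul, nrm2, Complex.norm_real, Real.norm_of_nonneg hs.le, mul_one,
      ← dist_eq_norm, ← dist_eq_norm] at B
    rw [A] at B
    have : (s * t - 1) * dist a c'' = 0 := by linarith
    rcases mul_eq_zero.1 this with h | h <;> linarith
  have stC : (s : ℂ) * t = 1 := by exact_mod_cast st
  subst r1
  set w : ℂ := -(1 / 2) + (h : ℂ) * Complex.I with hw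
  obtain ⟨U, hU⟩ : ∃ U, U = (c' - a) * w := ⟨_, rfl⟩
  have hw0 : w ≠ 0 := by intro h0; rw [h0] at nrm2; simp at nrm2
  have hU0 : U ≠ 0 := by rw [hU]; exact mul_ne_zero n1 hw0
  have E1 : c' - a = U * (-(1 / 2) - h * Complex.I) := by
    rw [hU, hw]
    linear_combination (c' - a) * (hI * h ^ 2 - hhC)
  have hw3 : w ^ 3 = 1 := by
    rw [hw]
    linear_combination (h ^ 3 * Complex.I - 3 / 2 * h ^ 2) * hI + (3 / 2 - h * Complex.I) * hhC
  have er' : c' - a = -(a - c'') * w := by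
    rw [er, hw]; push_cast; ring
  have E2 : c'' - a = U * (-(1 / 2) + h * Complex.I) := by
    rw [hU, er', ← hw]
    linear_combination (a - c'') * hw3
  have E3 : e' - a = U * (t - 1 / 2 - h * Complex.I) := by
    linear_combination et + E1 - t * hU
  have E4 : e'' - a = U * (t - 1 / 2 + h * Complex.I) := by
    have : e'' - c'' = t * U := by
      rw [hU, er']
      linear_combination t * w ^ 2 * es + (c'' - e'') * (stC * w ^ 3 + hw3)
    linear_combination this + E2
  obtain ⟨g, hg⟩ : ∃ g, g = (f' - a) / U := ⟨_, rfl⟩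
  have E5 : f' - a = U * g := by rw [hg]; field_simp
  have conjU : (starRingEnd ℂ) U * U = ((‖U‖ ^ 2 : ℝ) : ℂ) := by rw [Complex.conj_mul']; push_cast; rfl
  have hUp : 0 < ‖U‖ ^ 2 := by have := norm_pos_iff.2 hU0; positivity
  have key : ∀ x y : ℂ, 0 < ((starRingEnd ℂ) (U * x) * (U * y)).im →
      0 < ((starRingEnd ℂ) x * y).im := by
    intro x y hxy
    have e : (starRingEnd ℂ) (U * x) * (U * y) = ((‖U‖ ^ 2 : ℝ) : ℂ) * ((starRingEnd ℂ) x * y) := by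
      rw [← conjU, map_mul]; ring
    rw [e, Complex.im_ofReal_mul] at hxy
    exact pos_of_mul_pos_right hxy hUp.le
  have F1 : e' - c' = U * t := by linear_combination E3 - E1
  have F2 : f' - e' = U * (g - (t - 1 / 2 - h * Complex.I)) := by linear_combination E5 - E3
  have F3 : e'' - f' = U * ((t - 1 / 2 + h * Complex.I) - g) := by linear_combination E4 - E5
  have F4 : c'' - e'' = U * (-t) := by linear_combination E2 - E4
  rw [F1, F2] at i2
  rw [F2, F3] at i3
  rw [F3, F4] at i4
  replace i2 := key _ _ i2
  replace i3 := key _ _ i3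
  replace i4 := key _ _ i4
  simp at i2 i3 i4
  have g1 : -h < g.im := by nlinarith
  have g2 : g.im < h := by nlinarith
  have g3 : t - 1 / 2 < g.re := by
    have q : 0 < 2 * h * (g.re - (t - 1 / 2)) := by linarith
    have := pos_of_mul_pos_right q (by linarith)
    linarith
  have ez : (t - 1 / 2 - h * Complex.I : ℂ) = ⟨t - 1/2, -h⟩ := by
    apply Complex.ext <;> simp
  have ec : (-(1 / 2) - h * Complex.I : ℂ) = ⟨-1/2, -h⟩ := by
    apply Complex.ext <;> simp
    norm_num
  rw [ez] at E3
  rw [ec] at E1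
  have hz0 : (⟨t - 1/2, -h⟩ : ℂ) ≠ 0 := by
    intro h0; have := congrArg Complex.im h0; simp at this; linarith
  have hc0 : (⟨-1/2, -h⟩ : ℂ) ≠ 0 := by
    intro h0; have := congrArg Complex.im h0; simp at this; linarith
  have hgn : ‖g‖ = ‖(⟨t - 1/2, -h⟩ : ℂ)‖ := by
    rw [dist_comm, dist_comm a, dist_eq_norm, dist_eq_norm, E3, E5, norm_mul, norm_mul] at hdf
    exact (mul_left_cancel₀ (norm_ne_zero_iff.2 hU0) hdf).symm
  have hg0 : g ≠ 0 := by
    rw [← norm_ne_zero_iff, hgn, norm_ne_zero_iff]; exact hz0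
  obtain ⟨φ', ψ, p1, p2, p3, p4, p5, p6, p7, p8⟩ := core ht hh hgn g1 g2 g3
  have hφ' : φ = φ' := by
    rw [hφ, EuclideanGeometry.angle, vsub_eq_sub, vsub_eq_sub, E1, E3,
      Complex.angle_eq_abs_arg (mul_ne_zero hU0 hc0) (mul_ne_zero hU0 hz0),
      mul_div_mul_left _ _ hU0, p1, abs_neg, abs_of_pos p3]
  have hψ : EuclideanGeometry.angle f' a e' = ψ := by
    rw [EuclideanGeometry.angle, vsub_eq_sub, vsub_eq_sub, E5, E3,
      Complex.angle_eq_abs_arg (mul_ne_zero hU0 hg0) (mul_ne_zero hU0 hz0),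
      mul_div_mul_left _ _ hU0, p2, abs_of_pos p5]
  have hne : e' ≠ a := by
    rw [← sub_ne_zero, E3]; exact mul_ne_zero hU0 hz0
  have hsum := EuclideanGeometry.angle_add_angle_add_angle_eq_pi f' hne
  have hiso := EuclideanGeometry.angle_eq_angle_of_dist_eq hdf
  rw [EuclideanGeometry.angle_comm e' f' a, ← hiso, ← hα, hψ] at hsum
  have hα' : α = (π - ψ) / 2 := by linarith
  subst hφ' hα'
  exact ⟨⟨p3, p4⟩, ⟨by linarith, by linarith⟩, p7, p8⟩
end

section
/- For any real numbers φ and α satisfying 0 < φ < 2π/3, 0 < α < π/2 and φ − π/6 < α < φ + π/3, there exists a 4-special polygon P with angle parameters φ(P) = φ and α(P) = α; moreover, if P₁ is any other 4-special polygon with φ(P₁) = φ and α(P₁) = α, then P₁ is directly similar to P. -/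
open Real EuclideanGeometry

attribute [local instance] Complex.finrank_real_complex_fact

/-- The unit complex number of argument `x`. -/
noncomputable def E (x : ℝ) : ℂ := ⟨Real.cos x, Real.sin x⟩

lemma E_re (x : ℝ) : (E x).re = Real.cos x := rfl
lemma E_im (x : ℝ) : (E x).im = Real.sin x := rfl

lemma E_eq (x : ℝ) : E x = Complex.cos x + Complex.sin x * Complex.I := by
  apply Complex.ext
  · simp [E_re, ← Complex.ofReal_cos, ← Complex.ofReal_sin]
  · simp [E_im, ← Complex.ofReal_cos, ← Complex.ofReal_sin]

lemma E_add (x y : ℝ) : E (x + y) = E x * E y := by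
  apply Complex.ext
  · simp [E_re, E_im, Real.cos_add]
  · simp [E_re, E_im, Real.sin_add]; ring

lemma E_zero : E 0 = 1 := by apply Complex.ext <;> simp [E_re, E_im]
lemma E_pi : E π = -1 := by apply Complex.ext <;> simp [E_re, E_im]
lemma E_two_pi : E (2 * π) = 1 := by apply Complex.ext <;> simp [E_re, E_im]

lemma E_ne (x : ℝ) : E x ≠ 0 := by
  intro h
  have h1 : E (x + -x) = 0 := by rw [E_add, h, zero_mul]
  rw [add_neg_cancel, E_zero] at h1
  exact one_ne_zero h1

lemma norm_E (x : ℝ) : ‖E x‖ = 1 := by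
  rw [E_eq, Complex.norm_cos_add_sin_mul_I]

lemma norm_rE {r : ℝ} (hr : 0 < r) (x : ℝ) : ‖(r : ℂ) * E x‖ = r := by
  rw [norm_mul, norm_E, mul_one, Complex.norm_real, Real.norm_of_nonneg hr.le]

lemma arg_E {r θ : ℝ} (hr : 0 < r) (h1 : -π < θ) (h2 : θ ≤ π) : ((r : ℂ) * E θ).arg = θ := by
  rw [E_eq]; exact Complex.arg_mul_cos_add_sin_mul_I hr ⟨h1, h2⟩

lemma polar (z : ℂ) : z = (‖z‖ : ℂ) * E z.arg := by
  rw [E_eq]; exact (Complex.norm_mul_cos_add_sin_mul_I z).symm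

lemma E_sub (r x y : ℝ) :
    (r : ℂ) * E x - r * E y = ((2 * r * Real.sin ((x - y) / 2) : ℝ) : ℂ) * E ((x + y) / 2 + π / 2) := by
  have hx : x = (x + y) / 2 + (x - y) / 2 := by ring
  have hy : y = (x + y) / 2 - (x - y) / 2 := by ring
  generalize (x + y) / 2 = m at *
  generalize (x - y) / 2 = d at *
  subst hx; subst hy
  apply Complex.ext
  · simp [E_re, E_im, Real.cos_add, Real.sin_add, Real.cos_sub, Complex.sin_ofReal_re]; ring
  · simp [E_re, E_im, Real.cos_add, Real.sin_add, Real.sin_sub, Complex.sin_ofReal_re]; ring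

lemma turn_eq_s3 {p q r s : ℂ} {k₁ k₂ x y θ : ℝ} (hs : s ≠ 0) (hk₁ : 0 < k₁) (hk₂ : 0 < k₂)
    (h1 : q - p = s * (k₁ * E x)) (h2 : r - q = s * (k₂ * E y))
    (hθ : E y = E (x + θ)) (ha : -π < θ) (hb : θ ≤ π) : turn p q r = θ := by
  unfold turn
  rw [Complex.oangle, h1, h2, hθ, E_add]
  have : (starRingEnd ℂ) (s * (k₁ * E x)) * (s * (k₂ * (E x * E θ)))
      = ((‖s‖ ^ 2 * k₁ * k₂ : ℝ) : ℂ) * E θ := by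
    have e1 : (starRingEnd ℂ) s * s = ((‖s‖ ^ 2 : ℝ) : ℂ) := by
      rw [Complex.conj_mul']; push_cast; rfl
    have e2 : (starRingEnd ℂ) (E x) * E x = 1 := by
      rw [Complex.conj_mul', norm_E]; simp
    simp only [map_mul, Complex.conj_ofReal]
    push_cast at e1 ⊢
    linear_combination (k₁ * k₂ * E θ * (starRingEnd ℂ) (E x) * E x) * e1 + (‖s‖ ^ 2 * k₁ * k₂ * E θ) * e2
  rw [this, arg_E (by have := norm_pos_iff.2 hs; positivity) ha hb]
  rw [Real.Angle.toReal_coe_eq_self_iff]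
  exact ⟨ha, hb⟩

lemma of_turn {p q r : ℂ} {θ : ℝ} (h : turn p q r = θ) (hp : q - p ≠ 0) (hr : r - q ≠ 0) :
    ∃ k : ℝ, 0 < k ∧ r - q = k * E θ * (q - p) := by
  unfold turn at h
  rw [Complex.oangle, Real.Angle.toReal_coe_eq_self_iff.2
    ⟨Complex.neg_pi_lt_arg _, Complex.arg_le_pi _⟩] at h
  refine ⟨‖r - q‖ / ‖q - p‖, by positivity, ?_⟩
  have := polar ((starRingEnd ℂ) (q - p) * (r - q))
  rw [h, norm_mul, RCLike.norm_conj] at this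
  have e1 : (starRingEnd ℂ) (q - p) * (q - p) = ((‖q - p‖ ^ 2 : ℝ) : ℂ) := by
    rw [Complex.conj_mul']; push_cast; rfl
  have n : (‖q - p‖ : ℂ) ≠ 0 := by simpa using hp
  have c : (starRingEnd ℂ) (q - p) ≠ 0 := (map_ne_zero _).2 hp
  apply mul_left_cancel₀ c
  rw [this]
  push_cast at e1 ⊢
  field_simp
  linear_combination (-‖r - q‖ * E θ) * e1

lemma seg_arg {r s x y : ℝ} (hr : 0 < r) (hs : 0 < s) (hx : -π < x) (hxy : x < y) (hy : y ≤ π)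
    (hd : y - x < π) {z : ℂ} (hz : z ∈ segment ℝ ((r : ℂ) * E x) ((s : ℂ) * E y)) :
    z ≠ 0 ∧ x ≤ z.arg ∧ z.arg ≤ y ∧ (z.arg = x → z = r * E x) ∧ (z.arg = y → z = s * E y) := by
  obtain ⟨a, b, ha, hb, hab, rfl⟩ := hz
  obtain ⟨m, d, rfl, rfl⟩ : ∃ m d, x = m - d ∧ y = m + d := ⟨(x + y) / 2, (y - x) / 2, by ring, by ring⟩
  have hd0 : 0 < d := by linarith
  have hd1 : d < π / 2 := by linarith
  have hc : 0 < Real.cos d := Real.cos_pos_of_mem_Ioo ⟨by linarith, hd1⟩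
  have hsn : 0 < Real.sin (2 * d) := Real.sin_pos_of_pos_of_lt_pi (by linarith) (by linarith)
  set w : ℂ := (a * r : ℝ) * E (-d) + (b * s : ℝ) * E d with hw
  have hzw : a • ((r : ℂ) * E (m - d)) + b • ((s : ℂ) * E (m + d)) = E m * w := by
    rw [hw, sub_eq_add_neg, E_add, E_add]; simp only [Complex.real_smul]; push_cast; ring
  have hre : w.re = (a * r + b * s) * Real.cos d := by
    simp [hw, E_re, E_im]; ring
  have hpos : 0 < a * r + b * s := by
    rcases ha.lt_or_eq with h | h
    · have := mul_pos h hr; have := mul_nonneg hb hs.le; linarith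
    · have : b = 1 := by linarith
      subst this; rw [← h]; linarith
  have hre' : 0 < w.re := by rw [hre]; positivity
  have harg := Complex.abs_arg_lt_pi_div_two_iff.2 (Or.inl hre')
  rw [abs_lt] at harg
  have hw0 : w ≠ 0 := by intro h; rw [h] at hre'; simp at hre'
  have hn : 0 < ‖w‖ := norm_pos_iff.2 hw0
  have hpw := polar w
  have i1 : ‖w‖ * Real.sin (w.arg + d) = b * s * Real.sin (2 * d) := by
    have : (w * E d).im = b * s * Real.sin (2 * d) := by
      rw [hw]; simp [E_re, E_im, Real.sin_two_mul]; ring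
    rw [← this]; conv_rhs => rw [hpw, mul_assoc, ← E_add]
    simp [E_im]
  have i2 : ‖w‖ * Real.sin (w.arg - d) = -(a * r * Real.sin (2 * d)) := by
    have : (w * E (-d)).im = -(a * r * Real.sin (2 * d)) := by
      rw [hw]; simp [E_re, E_im, Real.sin_two_mul]; ring
    rw [← this]; conv_rhs => rw [hpw, mul_assoc, ← E_add]
    simp [E_im, sub_eq_add_neg]
  have j1 : -d ≤ w.arg := by
    by_contra hcon
    have : Real.sin (w.arg + d) < 0 := Real.sin_neg_of_neg_of_neg_pi_lt (by linarith) (by linarith)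
    have h3 : 0 ≤ b * s * Real.sin (2 * d) := by positivity
    nlinarith [mul_pos_of_neg_of_neg this (neg_lt_zero.2 hn)]
  have j2 : w.arg ≤ d := by
    by_contra hcon
    have : 0 < Real.sin (w.arg - d) := Real.sin_pos_of_pos_of_lt_pi (by linarith) (by linarith)
    have h3 : 0 ≤ a * r * Real.sin (2 * d) := by positivity
    nlinarith [mul_pos this hn]
  have hz : (E m * w).arg = m + w.arg := by
    have : E m * w = (‖w‖ : ℂ) * E (m + w.arg) := by
      rw [E_add]; conv_lhs => rw [hpw]
      ring
    rw [this, arg_E hn (by linarith) (by linarith)]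
  rw [hzw, hz]
  refine ⟨mul_ne_zero (E_ne m) hw0, by linarith, by linarith, fun h => ?_, fun h => ?_⟩
  · have h4 : w.arg + d = 0 := by linarith
    rw [h4, Real.sin_zero, mul_zero] at i1
    have : b = 0 := by
      by_contra h; exact (by positivity : b * s * Real.sin (2 * d) ≠ 0) i1.symm
    have a1 : a = 1 := by linarith
    rw [← hzw, this, a1]; simp
  · have h4 : w.arg - d = 0 := by linarith
    rw [h4, Real.sin_zero, mul_zero] at i2
    have : a = 0 := by
      by_contra h; exact (by positivity : a * r * Real.sin (2 * d) ≠ 0) (by linarith)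
    have a1 : b = 1 := by linarith
    rw [← hzw, this, a1]; simp

lemma seg_zero {r x : ℝ} (hr : 0 < r) (hx : -π < x) (hy : x ≤ π) {z : ℂ}
    (hz : z ∈ segment ℝ (0 : ℂ) ((r : ℂ) * E x)) : z = 0 ∨ z.arg = x := by
  obtain ⟨a, b, ha, hb, hab, rfl⟩ := hz
  rcases hb.lt_or_eq with h | h
  · right
    have : a • (0 : ℂ) + b • ((r : ℂ) * E x) = ((b * r : ℝ) : ℂ) * E x := by
      simp only [Complex.real_smul]; push_cast; ring
    rw [this, arg_E (by positivity) hx hy]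
  · left; simp [← h]

lemma inter_eq {p q r : ℂ}
    (h : ∀ z, z ∈ segment ℝ p q → z ∈ segment ℝ q r → z = q) :
    segment ℝ p q ∩ segment ℝ q r = {q} := by
  apply Set.Subset.antisymm
  · rintro z ⟨h1, h2⟩; exact h z h1 h2
  · rintro z rfl; exact ⟨right_mem_segment _ _ _, left_mem_segment _ _ _⟩

lemma star_simple {r₀ r₁ r₂ r₃ r₄ t₀ t₁ t₂ t₃ t₄ : ℝ} (hr₀ : 0 < r₀) (hr₁ : 0 < r₁) (hr₂ : 0 < r₂)
    (hr₃ : 0 < r₃) (hr₄ : 0 < r₄) (h₀ : -π < t₀) (h₁ : t₀ < t₁) (h₂ : t₁ < t₂) (h₃ : t₂ < t₃)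
    (h₄ : t₃ < t₄) (h₅ : t₄ ≤ π) (g₁ : t₁ - t₀ < π) (g₂ : t₂ - t₁ < π) (g₃ : t₃ - t₂ < π)
    (g₄ : t₄ - t₃ < π) :
    IsSimplePolygon ![0, (r₀ : ℂ) * E t₀, (r₁ : ℂ) * E t₁, (r₂ : ℂ) * E t₂, (r₃ : ℂ) * E t₃,
      (r₄ : ℂ) * E t₄] := by
  have A0 := arg_E hr₀ h₀ (by linarith : t₀ ≤ π)
  have A1 := arg_E hr₁ (by linarith : -π < t₁) (by linarith : t₁ ≤ π)
  have A2 := arg_E hr₂ (by linarith : -π < t₂) (by linarith : t₂ ≤ π)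
  have A3 := arg_E hr₃ (by linarith : -π < t₃) (by linarith : t₃ ≤ π)
  have A4 := arg_E hr₄ (by linarith : -π < t₄) h₅
  have S0 := fun z => seg_zero hr₀ h₀ (by linarith) (z := z)
  have S5 := fun z => seg_zero hr₄ (by linarith) h₅ (z := z)
  have S1 := fun z => seg_arg hr₀ hr₁ h₀ h₁ (by linarith) g₁ (z := z)
  have S2 := fun z => seg_arg hr₁ hr₂ (by linarith) h₂ (by linarith) g₂ (z := z)
  have S3 := fun z => seg_arg hr₂ hr₃ (by linarith) h₃ (by linarith) g₃ (z := z)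
  have S4 := fun z => seg_arg hr₃ hr₄ (by linarith) h₄ h₅ g₄ (z := z)
  have N0 : (r₀ : ℂ) * E t₀ ≠ 0 := mul_ne_zero (by exact_mod_cast hr₀.ne') (E_ne _)
  have N4 : (r₄ : ℂ) * E t₄ ≠ 0 := mul_ne_zero (by exact_mod_cast hr₄.ne') (E_ne _)
  generalize (r₀ : ℂ) * E t₀ = p₀ at *
  generalize (r₁ : ℂ) * E t₁ = p₁ at *
  generalize (r₂ : ℂ) * E t₂ = p₂ at *
  generalize (r₃ : ℂ) * E t₃ = p₃ at *
  generalize (r₄ : ℂ) * E t₄ = p₄ at *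
  refine ⟨?_, ?_, ?_⟩
  · intro i
    fin_cases i
    · exact N0.symm
    · change p₀ ≠ p₁
      intro h; rw [h] at A0; linarith
    · change p₁ ≠ p₂
      intro h; rw [h] at A1; linarith
    · change p₂ ≠ p₃
      intro h; rw [h] at A2; linarith
    · change p₃ ≠ p₄
      intro h; rw [h] at A3; linarith
    · exact N4
  · intro i
    fin_cases i
    · change segment ℝ 0 p₀ ∩ segment ℝ p₀ p₁ = {p₀}
      apply inter_eq
      intro z ha hb
      obtain ⟨b1, b2, b3, b4, b5⟩ := S1 z hb
      exact b4 ((S0 z ha).resolve_left b1)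
    · change segment ℝ p₀ p₁ ∩ segment ℝ p₁ p₂ = {p₁}
      apply inter_eq
      intro z ha hb
      obtain ⟨b1, b2, b3, b4, b5⟩ := S1 z ha
      obtain ⟨c1, c2, c3, c4, c5⟩ := S2 z hb
      exact b5 (by linarith)
    · change segment ℝ p₁ p₂ ∩ segment ℝ p₂ p₃ = {p₂}
      apply inter_eq
      intro z ha hb
      obtain ⟨b1, b2, b3, b4, b5⟩ := S2 z ha
      obtain ⟨c1, c2, c3, c4, c5⟩ := S3 z hb
      exact b5 (by linarith)
    · change segment ℝ p₂ p₃ ∩ segment ℝ p₃ p₄ = {p₃}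
      apply inter_eq
      intro z ha hb
      obtain ⟨b1, b2, b3, b4, b5⟩ := S3 z ha
      obtain ⟨c1, c2, c3, c4, c5⟩ := S4 z hb
      exact b5 (by linarith)
    · change segment ℝ p₃ p₄ ∩ segment ℝ p₄ 0 = {p₄}
      apply inter_eq
      intro z ha hb
      rw [segment_symm] at hb
      obtain ⟨b1, b2, b3, b4, b5⟩ := S4 z ha
      exact b5 ((S5 z hb).resolve_left b1)
    · change segment ℝ p₄ 0 ∩ segment ℝ 0 p₀ = {0}
      apply inter_eq
      intro z ha hb
      rw [segment_symm] at ha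
      by_contra h
      have := (S0 z hb).resolve_left h
      have := (S5 z ha).resolve_left h
      linarith
  · have key : ∀ i j : Fin 6, i < j → j ≠ i + 1 → j + 1 ≠ i →
        segment ℝ (![0, p₀, p₁, p₂, p₃, p₄] i) (![0, p₀, p₁, p₂, p₃, p₄] (i + 1)) ∩
        segment ℝ (![0, p₀, p₁, p₂, p₃, p₄] j) (![0, p₀, p₁, p₂, p₃, p₄] (j + 1)) = ∅ := by
      have D02 : segment ℝ 0 p₀ ∩ segment ℝ p₁ p₂ = ∅ := by
        rw [Set.eq_empty_iff_forall_notMem]; rintro z ⟨ha, hb⟩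
        obtain ⟨b1, b2, b3, -⟩ := S2 z hb
        have := (S0 z ha).resolve_left b1
        linarith
      have D03 : segment ℝ 0 p₀ ∩ segment ℝ p₂ p₃ = ∅ := by
        rw [Set.eq_empty_iff_forall_notMem]; rintro z ⟨ha, hb⟩
        obtain ⟨b1, b2, b3, -⟩ := S3 z hb
        have := (S0 z ha).resolve_left b1
        linarith
      have D04 : segment ℝ 0 p₀ ∩ segment ℝ p₃ p₄ = ∅ := by
        rw [Set.eq_empty_iff_forall_notMem]; rintro z ⟨ha, hb⟩
        obtain ⟨b1, b2, b3, -⟩ := S4 z hb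
        have := (S0 z ha).resolve_left b1
        linarith
      have D13 : segment ℝ p₀ p₁ ∩ segment ℝ p₂ p₃ = ∅ := by
        rw [Set.eq_empty_iff_forall_notMem]; rintro z ⟨ha, hb⟩
        obtain ⟨b1, b2, b3, -⟩ := S1 z ha
        obtain ⟨c1, c2, c3, -⟩ := S3 z hb
        linarith
      have D14 : segment ℝ p₀ p₁ ∩ segment ℝ p₃ p₄ = ∅ := by
        rw [Set.eq_empty_iff_forall_notMem]; rintro z ⟨ha, hb⟩
        obtain ⟨b1, b2, b3, -⟩ := S1 z ha
        obtain ⟨c1, c2, c3, -⟩ := S4 z hb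
        linarith
      have D24 : segment ℝ p₁ p₂ ∩ segment ℝ p₃ p₄ = ∅ := by
        rw [Set.eq_empty_iff_forall_notMem]; rintro z ⟨ha, hb⟩
        obtain ⟨b1, b2, b3, -⟩ := S2 z ha
        obtain ⟨c1, c2, c3, -⟩ := S4 z hb
        linarith
      have D15 : segment ℝ p₀ p₁ ∩ segment ℝ p₄ 0 = ∅ := by
        rw [Set.eq_empty_iff_forall_notMem, segment_symm ℝ p₄]; rintro z ⟨ha, hb⟩
        obtain ⟨b1, b2, b3, -⟩ := S1 z ha
        have := (S5 z hb).resolve_left b1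
        linarith
      have D25 : segment ℝ p₁ p₂ ∩ segment ℝ p₄ 0 = ∅ := by
        rw [Set.eq_empty_iff_forall_notMem, segment_symm ℝ p₄]; rintro z ⟨ha, hb⟩
        obtain ⟨b1, b2, b3, -⟩ := S2 z ha
        have := (S5 z hb).resolve_left b1
        linarith
      have D35 : segment ℝ p₂ p₃ ∩ segment ℝ p₄ 0 = ∅ := by
        rw [Set.eq_empty_iff_forall_notMem, segment_symm ℝ p₄]; rintro z ⟨ha, hb⟩
        obtain ⟨b1, b2, b3, -⟩ := S3 z ha
        have := (S5 z hb).resolve_left b1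
        linarith
      intro i j hij h1 h2
      fin_cases i <;> fin_cases j <;>
        first
        | exact absurd hij (by decide)
        | exact absurd rfl h1
        | exact absurd rfl h2
        | exact D02
        | exact D03
        | exact D04
        | exact D13
        | exact D14
        | exact D24
        | exact D15
        | exact D25
        | exact D35
    intro i j h1 h2 h3
    rcases lt_or_gt_of_ne h1 with h | h
    · rw [Set.inter_comm]; exact key j i h h3.symm h2.symm
    · exact key i j h h2 h3

lemma of_angle {u v : ℂ} {θ : ℝ} (h : InnerProductGeometry.angle u v = θ) (hu : u ≠ 0)
    (hv : v ≠ 0) : ∃ k : ℝ, 0 < k ∧ (v = k * E θ * u ∨ v = k * E (-θ) * u) := by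
  rw [InnerProductGeometry.angle_comm, Complex.angle_eq_abs_arg hv hu] at h
  refine ⟨‖v / u‖, norm_pos_iff.2 (div_ne_zero hv hu), ?_⟩
  have hp := polar (v / u)
  rw [div_eq_iff hu] at hp
  rcases abs_choice (v / u).arg with h' | h'
  · left; rw [← h, h']; exact hp
  · right; rw [← h, h', neg_neg]; exact hp

lemma angle_eq_of {u v : ℂ} {k₁ k₂ x θ : ℝ} (hk₁ : 0 < k₁) (hk₂ : 0 < k₂)
    (hu : u = k₁ * E x) (hv : v = k₂ * E (x + θ)) (h0 : 0 ≤ θ) (h1 : θ ≤ π) :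
    InnerProductGeometry.angle u v = θ := by
  have k1 : (k₁ : ℂ) ≠ 0 := by exact_mod_cast hk₁.ne'
  have k2 : (k₂ : ℂ) ≠ 0 := by exact_mod_cast hk₂.ne'
  have ex := E_ne x
  have hpi := Real.pi_pos
  rw [InnerProductGeometry.angle_comm, Complex.angle_eq_abs_arg (by rw [hv]; exact mul_ne_zero k2 (E_ne _))
    (by rw [hu]; exact mul_ne_zero k1 (E_ne _))]
  have : v / u = ((k₂ / k₁ : ℝ) : ℂ) * E θ := by
    rw [hu, hv, E_add]; push_cast; field_simp
  rw [this, arg_E (by positivity) (by linarith) h1, abs_of_nonneg h0]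

lemma cos_two_pi_div_three' : Real.cos (2 * π / 3) = -1 / 2 := by
  rw [show 2 * π / 3 = π - π / 3 by ring, Real.cos_pi_sub, Real.cos_pi_div_three]; ring

lemma sin_two_pi_div_three' : Real.sin (2 * π / 3) = √3 / 2 := by
  rw [show 2 * π / 3 = π - π / 3 by ring, Real.sin_pi_sub, Real.sin_pi_div_three]

lemma vertex_e₁ (φ : ℝ) : (Real.sin (2 * π / 3 - φ) : ℂ) * E (-(2 * π / 3)) + (Real.sin φ : ℂ)
    = (Real.sin (π / 3) : ℂ) * E (φ - 2 * π / 3) := by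
  have h3 : √3 * √3 = 3 := Real.mul_self_sqrt (by norm_num)
  apply Complex.ext
  · simp only [Complex.add_re, Complex.re_ofReal_mul, E_re, Complex.ofReal_re, Real.cos_neg,
      Real.sin_sub, Real.cos_sub, cos_two_pi_div_three', sin_two_pi_div_three', Real.sin_pi_div_three]
    linear_combination (-1 / 4 * Real.sin φ) * h3
  · simp only [Complex.add_im, Complex.im_ofReal_mul, E_im, Complex.ofReal_im, Real.sin_neg,
      Real.sin_sub, Real.cos_sub, cos_two_pi_div_three', sin_two_pi_div_three', Real.sin_pi_div_three]
    ring

lemma vertex_e₂ (φ : ℝ) : (Real.sin (2 * π / 3 - φ) : ℂ) * E (2 * π / 3) + (Real.sin φ : ℂ)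
    = (Real.sin (π / 3) : ℂ) * E (2 * π / 3 - φ) := by
  have h3 : √3 * √3 = 3 := Real.mul_self_sqrt (by norm_num)
  apply Complex.ext
  · simp only [Complex.add_re, Complex.re_ofReal_mul, E_re, Complex.ofReal_re,
      Real.sin_sub, Real.cos_sub, cos_two_pi_div_three', sin_two_pi_div_three', Real.sin_pi_div_three]
    linear_combination (-1 / 4 * Real.sin φ) * h3
  · simp only [Complex.add_im, Complex.im_ofReal_mul, E_im, Complex.ofReal_im,
      Real.sin_sub, Real.cos_sub, cos_two_pi_div_three', sin_two_pi_div_three', Real.sin_pi_div_three]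
    ring

section main

variable (φ α : ℝ)

lemma exists_part (hφ₀ : 0 < φ) (hφ₁ : φ < 2 * π / 3) (hα₀ : 0 < α) (hα₁ : α < π / 2)
    (h₀ : φ - π / 6 < α) (h₁ : α < φ + π / 3) :
    Is4Special 0 ((Real.sin (2 * π / 3 - φ) : ℂ) * E (-(2 * π / 3)))
      ((Real.sin (π / 3) : ℂ) * E (φ - 2 * π / 3))
      ((Real.sin (π / 3) : ℂ) * E (φ + π / 3 - 2 * α))
      ((Real.sin (π / 3) : ℂ) * E (2 * π / 3 - φ))
      ((Real.sin (2 * π / 3 - φ) : ℂ) * E (2 * π / 3)) ∧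
    EuclideanGeometry.angle ((Real.sin (2 * π / 3 - φ) : ℂ) * E (-(2 * π / 3))) 0
      ((Real.sin (π / 3) : ℂ) * E (φ - 2 * π / 3)) = φ ∧
    EuclideanGeometry.angle 0 ((Real.sin (π / 3) : ℂ) * E (φ - 2 * π / 3))
      ((Real.sin (π / 3) : ℂ) * E (φ + π / 3 - 2 * α)) = α := by
  have hpi := Real.pi_pos
  have v1 := vertex_e₁ φ
  have v2 := vertex_e₂ φ
  have hS : 0 < Real.sin (2 * π / 3 - φ) := Real.sin_pos_of_pos_of_lt_pi (by linarith) (by linarith)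
  have hq : 0 < Real.sin φ := Real.sin_pos_of_pos_of_lt_pi (by linarith) (by linarith)
  have hR : 0 < Real.sin (π / 3) := Real.sin_pos_of_pos_of_lt_pi (by linarith) (by linarith)
  have hca : 0 < Real.cos α := Real.cos_pos_of_mem_Ioo ⟨by linarith, hα₁⟩
  have hsb : 0 < Real.sin (π / 6 - φ + α) :=
    Real.sin_pos_of_pos_of_lt_pi (by linarith) (by linarith)
  have hsimp : IsSimplePolygon ![0, (Real.sin (2 * π / 3 - φ) : ℂ) * E (-(2 * π / 3)),
      (Real.sin (π / 3) : ℂ) * E (φ - 2 * π / 3),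
      (Real.sin (π / 3) : ℂ) * E (φ + π / 3 - 2 * α),
      (Real.sin (π / 3) : ℂ) * E (2 * π / 3 - φ),
      (Real.sin (2 * π / 3 - φ) : ℂ) * E (2 * π / 3)] := by
    apply star_simple <;> first | assumption | linarith
  have d3 : (Real.sin (π / 3) : ℂ) * E (φ + π / 3 - 2 * α) - (Real.sin (π / 3) : ℂ) * E (φ - 2 * π / 3)
      = ((2 * Real.sin (π / 3) * Real.cos α : ℝ) : ℂ) * E (φ + π / 3 - α) := by
    rw [E_sub, show (φ + π / 3 - 2 * α - (φ - 2 * π / 3)) / 2 = π / 2 - α by ring,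
      Real.sin_pi_div_two_sub]
    congr 2; ring
  have d4 : (Real.sin (π / 3) : ℂ) * E (2 * π / 3 - φ) - (Real.sin (π / 3) : ℂ) * E (φ + π / 3 - 2 * α)
      = ((2 * Real.sin (π / 3) * Real.sin (π / 6 - φ + α) : ℝ) : ℂ) * E (π - α) := by
    rw [E_sub]
    congr 2
    · congr 2; ring
    · ring
  have d2 : (Real.sin (π / 3) : ℂ) * E (φ - 2 * π / 3)
      - (Real.sin (2 * π / 3 - φ) : ℂ) * E (-(2 * π / 3)) = (Real.sin φ : ℂ) * E 0 := by
    rw [E_zero, ← v1]; ring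
  have d5 : (Real.sin (2 * π / 3 - φ) : ℂ) * E (2 * π / 3) - (Real.sin (π / 3) : ℂ) * E (2 * π / 3 - φ)
      = (Real.sin φ : ℂ) * E π := by
    rw [E_pi, ← v2]; ring
  have hd6 : E (5 * π / 3) = - E (2 * π / 3) := by
    rw [show 5 * π / 3 = 2 * π / 3 + π by ring, E_add, E_pi]; ring
  have d6 : 0 - (Real.sin (2 * π / 3 - φ) : ℂ) * E (2 * π / 3)
      = (Real.sin (2 * π / 3 - φ) : ℂ) * E (5 * π / 3) := by
    rw [hd6]; ring
  have d1 : (Real.sin (2 * π / 3 - φ) : ℂ) * E (-(2 * π / 3)) - 0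
      = (Real.sin (2 * π / 3 - φ) : ℂ) * E (-(2 * π / 3)) := sub_zero _
  have hE : E (-(2 * π / 3)) = E (5 * π / 3 + -(π / 3)) := by
    rw [show 5 * π / 3 + -(π / 3) = -(2 * π / 3) + 2 * π by ring, E_add _ (2 * π), E_two_pi, mul_one]
  have k3 : 0 < 2 * Real.sin (π / 3) * Real.cos α := by positivity
  have k4 : 0 < 2 * Real.sin (π / 3) * Real.sin (π / 6 - φ + α) := by positivity
  have n1 : dist (0 : ℂ) ((Real.sin (2 * π / 3 - φ) : ℂ) * E (-(2 * π / 3))) = Real.sin (2 * π / 3 - φ) := by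
    rw [dist_zero_left, norm_rE hS]
  have n5 : dist (0 : ℂ) ((Real.sin (2 * π / 3 - φ) : ℂ) * E (2 * π / 3)) = Real.sin (2 * π / 3 - φ) := by
    rw [dist_zero_left, norm_rE hS]
  have n2 : ∀ x, dist (0 : ℂ) ((Real.sin (π / 3) : ℂ) * E x) = Real.sin (π / 3) := by
    intro x; rw [dist_zero_left, norm_rE hR]
  have hang1 : EuclideanGeometry.angle ((Real.sin (2 * π / 3 - φ) : ℂ) * E (-(2 * π / 3))) 0
      ((Real.sin (π / 3) : ℂ) * E (φ - 2 * π / 3)) = φ := by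
    unfold EuclideanGeometry.angle
    simp only [vsub_eq_sub, sub_zero]
    exact angle_eq_of hS hR rfl (by congr 2; ring) hφ₀.le (by linarith)
  have hang2 : EuclideanGeometry.angle 0 ((Real.sin (π / 3) : ℂ) * E (φ - 2 * π / 3))
      ((Real.sin (π / 3) : ℂ) * E (φ + π / 3 - 2 * α)) = α := by
    unfold EuclideanGeometry.angle
    simp only [vsub_eq_sub]
    rw [InnerProductGeometry.angle_comm]
    refine angle_eq_of k3 hR d3 ?_ hα₀.le (by linarith)
    rw [show φ + π / 3 - α + α = φ - 2 * π / 3 + π by ring, E_add, E_pi]; ring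
  generalize hp1 : (Real.sin (2 * π / 3 - φ) : ℂ) * E (-(2 * π / 3)) = p1 at *
  generalize hp2 : (Real.sin (π / 3) : ℂ) * E (φ - 2 * π / 3) = p2 at *
  generalize hp3 : (Real.sin (π / 3) : ℂ) * E (φ + π / 3 - 2 * α) = p3 at *
  generalize hp4 : (Real.sin (π / 3) : ℂ) * E (2 * π / 3 - φ) = p4 at *
  generalize (Real.sin (2 * π / 3 - φ) : ℂ) * E (2 * π / 3) = p5 at *
  have one : (1 : ℂ) ≠ 0 := one_ne_zero
  have t0 : turn p5 0 p1 = -(π / 3) :=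
    turn_eq_s3 one hS hS (by rw [one_mul, d6]) (by rw [one_mul, d1, hp1]) hE (by linarith) (by linarith)
  have t1 : turn 0 p1 p2 = 2 * π / 3 :=
    turn_eq_s3 (x := -(2 * π / 3)) one hS hq (by rw [one_mul, d1, hp1]) (by rw [one_mul, d2]) (by congr 1; ring) (by linarith) (by linarith)
  have t2 : turn p1 p2 p3 = φ + π / 3 - α :=
    turn_eq_s3 one hq k3 (by rw [one_mul, d2]) (by rw [one_mul, d3]) (by congr 1; ring) (by linarith) (by linarith)
  have t3 : turn p2 p3 p4 = 2 * π / 3 - φ :=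
    turn_eq_s3 one k3 k4 (by rw [one_mul, d3]) (by rw [one_mul, d4]) (by congr 1; ring) (by linarith) (by linarith)
  have t4 : turn p3 p4 p5 = α :=
    turn_eq_s3 one k4 hq (by rw [one_mul, d4]) (by rw [one_mul, d5]) (by congr 1; ring) (by linarith) (by linarith)
  have t5 : turn p4 p5 0 = 2 * π / 3 :=
    turn_eq_s3 one hq hS (by rw [one_mul, d5]) (by rw [one_mul, d6]) (by congr 1; ring) (by linarith) (by linarith)
  refine ⟨⟨hsimp, ?_, ?_, ?_, ?_, ?_, ?_, ?_, ?_, ?_, ?_⟩, hang1, hang2⟩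
  · unfold IsCCW
    rw [Fin.sum_univ_six]
    change turn p5 0 p1 + turn 0 p1 p2 + turn p1 p2 p3 + turn p2 p3 p4 + turn p3 p4 p5 + turn p4 p5 0 = _
    rw [t0, t1, t2, t3, t4, t5]; ring
  · change π - turn p5 0 p1 = _
    rw [t0]; ring
  · intro i hi
    fin_cases i
    · exact absurd rfl hi
    · change π - turn 0 p1 p2 < π
      linarith
    · change π - turn p1 p2 p3 < π
      linarith
    · change π - turn p2 p3 p4 < π
      linarith
    · change π - turn p3 p4 p5 < π
      linarith
    · change π - turn p4 p5 0 < π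
      linarith
  · change π - turn 0 p1 p2 = _
    rw [t1]; ring
  · change π - turn p4 p5 0 = _
    rw [t5]; ring
  · rw [n1, n5]
  · refine ⟨1, ?_⟩
    rw [one_smul, d2, E_zero, ← neg_sub, d5, E_pi]; ring
  · rw [dist_comm, dist_eq_norm, d2, dist_comm, dist_comm p4, dist_eq_norm, d5, norm_rE hq, norm_rE hq]
  · rw [← hp2, ← hp3, n2, n2]
  · rw [← hp3, ← hp4, n2, n2]

lemma unique_part (hφ₀ : 0 < φ) (hφ₁ : φ < 2 * π / 3) (hα₀ : 0 < α) (hα₁ : α < π / 2)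
    (a c e f e2 c2 : ℂ) (H : Is4Special a c e f e2 c2)
    (hang1 : EuclideanGeometry.angle c a e = φ) (hang2 : EuclideanGeometry.angle a e f = α) :
    ∃ s : ℂ, s ≠ 0 ∧ c - a = s * ((Real.sin (2 * π / 3 - φ) : ℂ) * E (-(2 * π / 3))) ∧
      e - a = s * ((Real.sin (π / 3) : ℂ) * E (φ - 2 * π / 3)) ∧
      f - a = s * ((Real.sin (π / 3) : ℂ) * E (φ + π / 3 - 2 * α)) ∧
      e2 - a = s * ((Real.sin (π / 3) : ℂ) * E (2 * π / 3 - φ)) ∧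
      c2 - a = s * ((Real.sin (2 * π / 3 - φ) : ℂ) * E (2 * π / 3)) := by
  obtain ⟨⟨hne, -, -⟩, -, i0, iall, i1, i5, dac, -, dce, dae, daf⟩ := H
  have hpi := Real.pi_pos
  have v1 := vertex_e₁ φ
  have v2 := vertex_e₂ φ
  have hS : 0 < Real.sin (2 * π / 3 - φ) := Real.sin_pos_of_pos_of_lt_pi (by linarith) (by linarith)
  have hq : 0 < Real.sin φ := Real.sin_pos_of_pos_of_lt_pi (by linarith) (by linarith)
  have hR : 0 < Real.sin (π / 3) := Real.sin_pos_of_pos_of_lt_pi (by linarith) (by linarith)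
  have hca : 0 < Real.cos α := Real.cos_pos_of_mem_Ioo ⟨by linarith, hα₁⟩
  have m1 : a ≠ c := hne 0
  have m2 : c ≠ e := hne 1
  have m3 : e ≠ f := hne 2
  have m4 : f ≠ e2 := hne 3
  have m5 : e2 ≠ c2 := hne 4
  have m6 : c2 ≠ a := hne 5
  have t0 : turn c2 a c = -(π / 3) := by
    have : π - turn c2 a c = 4 * π / 3 := i0
    linarith
  have t1 : turn a c e = 2 * π / 3 := by
    have : π - turn a c e = π / 3 := i1
    linarith
  have t5 : turn e2 c2 a = 2 * π / 3 := by
    have : π - turn e2 c2 a = π / 3 := i5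
    linarith
  have t3 : 0 < turn e f e2 := by
    have : π - turn e f e2 < π := iall 3 (by decide)
    linarith
  have t4 : 0 < turn f e2 c2 := by
    have : π - turn f e2 c2 < π := iall 4 (by decide)
    linarith
  have hSc : (Real.sin (2 * π / 3 - φ) : ℂ) ≠ 0 := by exact_mod_cast hS.ne'
  have hRc : (Real.sin (π / 3) : ℂ) ≠ 0 := by exact_mod_cast hR.ne'
  obtain ⟨k0, hk0, e0⟩ := of_turn t0 (sub_ne_zero.2 m6.symm) (sub_ne_zero.2 m1.symm)
  obtain ⟨k1, hk1, e1⟩ := of_turn t1 (sub_ne_zero.2 m1.symm) (sub_ne_zero.2 m2.symm)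
  obtain ⟨k5, hk5, e5⟩ := of_turn t5 (sub_ne_zero.2 m5.symm) (sub_ne_zero.2 m6.symm)
  have k01 : k0 = 1 := by
    rw [dist_comm, dist_eq_norm, dist_eq_norm, e0, norm_mul, norm_rE hk0] at dac
    have : ‖a - c2‖ ≠ 0 := norm_ne_zero_iff.2 (sub_ne_zero.2 m6.symm)
    exact mul_right_cancel₀ this (by rw [dac, one_mul])
  obtain ⟨s, hs⟩ : ∃ s : ℂ, c - a = s * ((Real.sin (2 * π / 3 - φ) : ℂ) * E (-(2 * π / 3))) :=
    ⟨(c - a) / ((Real.sin (2 * π / 3 - φ) : ℂ) * E (-(2 * π / 3))),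
      (div_mul_cancel₀ _ (mul_ne_zero hSc (E_ne _))).symm⟩
  have hs0 : s ≠ 0 := by
    rintro rfl
    rw [zero_mul] at hs; exact m1 (sub_eq_zero.1 hs).symm
  have hc2 : c2 - a = s * ((Real.sin (2 * π / 3 - φ) : ℂ) * E (2 * π / 3)) := by
    rw [hs, k01] at e0
    have x1 : E (-(2 * π / 3)) = - (E (-(π / 3)) * E (2 * π / 3)) := by
      rw [← E_add, show -(2 * π / 3) = -(π / 3) + 2 * π / 3 + π - 2 * π + 0 by ring]
      rw [show -(π / 3) + 2 * π / 3 + π - 2 * π + 0 = (-(π / 3) + 2 * π / 3) + -π by ring, E_add _ (-π)]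
      have : E (-π) = -1 := by apply Complex.ext <;> simp [E_re, E_im]
      rw [this]; ring
    rw [x1] at e0
    apply mul_left_cancel₀ (E_ne (-(π / 3)))
    push_cast at e0 ⊢
    linear_combination e0
  have he2 : e2 - c2 = s * ((Real.sin (2 * π / 3 - φ) / k5 : ℝ) : ℂ) := by
    have hk : (k5 : ℂ) ≠ 0 := by exact_mod_cast hk5.ne'
    apply mul_left_cancel₀ (mul_ne_zero hk (E_ne (2 * π / 3)))
    have : (k5 : ℂ) * E (2 * π / 3) * (s * ((Real.sin (2 * π / 3 - φ) / k5 : ℝ) : ℂ))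
        = s * (Real.sin (2 * π / 3 - φ) * E (2 * π / 3)) := by
      rw [Complex.ofReal_div]; field_simp
    rw [this]
    linear_combination hc2 + e5
  have hk15 : k1 * Real.sin (2 * π / 3 - φ) = Real.sin (2 * π / 3 - φ) / k5 := by
    rw [dist_comm, dist_eq_norm, dist_comm c2, dist_eq_norm, e1, he2, norm_mul, norm_rE hk1, hs, norm_mul,
      norm_rE hS, norm_mul, Complex.norm_real, Real.norm_of_nonneg (by positivity)] at dce
    have : ‖s‖ ≠ 0 := norm_ne_zero_iff.2 hs0
    apply mul_left_cancel₀ this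
    linear_combination dce
  have hea : e - a ≠ 0 := by
    intro h
    have h0 : dist a e = 0 := by rw [dist_comm, dist_eq_norm, h, norm_zero]
    rw [h0] at dae
    have : a = f := dist_eq_zero.1 dae.symm
    exact m3 (by rw [← this]; exact sub_eq_zero.1 h)
  have hE1 : E (2 * π / 3) * E (-(2 * π / 3)) = 1 := by
    rw [← E_add, add_neg_cancel, E_zero]
  -- the value of `k1`
  have hk1S : k1 * Real.sin (2 * π / 3 - φ) = Real.sin φ := by
    have hx : ∀ k x : ℝ, e - a = k * E x * (c - a) →
        (1 - k1 / 2 = k * Real.cos x ∧ k1 * (√3 / 2) = k * Real.sin x) := by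
      intro k x h
      have h' : 1 + k1 * E (2 * π / 3) = k * E x := by
        apply mul_right_cancel₀ (sub_ne_zero.2 m1.symm)
        linear_combination h - e1
      have hr := congrArg Complex.re h'
      have hi := congrArg Complex.im h'
      simp only [Complex.add_re, Complex.add_im, Complex.re_ofReal_mul, Complex.im_ofReal_mul, E_re, E_im,
        Complex.one_re, Complex.one_im, cos_two_pi_div_three', sin_two_pi_div_three'] at hr hi
      exact ⟨by linarith, by linarith⟩
    obtain ⟨k, hk, h | h⟩ := of_angle (u := c - a) (v := e - a) hang1 (sub_ne_zero.2 m1.symm) hea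
    · obtain ⟨hr, hi⟩ := hx _ _ h
      rw [Real.sin_sub, cos_two_pi_div_three', sin_two_pi_div_three']
      linear_combination Real.cos φ * hi - Real.sin φ * hr
    · obtain ⟨hr, hi⟩ := hx _ _ h
      rw [Real.sin_neg] at hi
      have : 0 < k1 * (√3 / 2) := by positivity
      have := mul_pos hk hq
      linarith
  have hk1Sc : (k1 : ℂ) * (Real.sin (2 * π / 3 - φ) : ℂ) = (Real.sin φ : ℂ) := by exact_mod_cast hk1S
  have hE' : e - a = s * ((Real.sin (π / 3) : ℂ) * E (φ - 2 * π / 3)) := by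
    rw [← v1, ← hk1Sc]
    rw [hs] at e1
    linear_combination e1 + hs + (k1 * s * Real.sin (2 * π / 3 - φ)) * hE1
  have hE2 : e2 - a = s * ((Real.sin (π / 3) : ℂ) * E (2 * π / 3 - φ)) := by
    rw [← v2]
    rw [← hk15, hk1S] at he2
    linear_combination he2 + hc2
  -- the position of `f`
  have hfe : f - e ≠ 0 := sub_ne_zero.2 m3.symm
  have hae : a - e ≠ 0 := by rw [← neg_sub]; exact neg_ne_zero.2 hea
  have hm : ∀ m x : ℝ, 0 < m → f - e = m * E x * (a - e) → m = 2 * Real.cos x := by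
    intro m x hm h
    have h1 : f - a = (e - a) * (1 - m * E x) := by linear_combination h
    rw [dist_comm, dist_eq_norm, dist_comm, dist_eq_norm, h1, norm_mul] at dae
    have h2 : ‖1 - (m : ℂ) * E x‖ = 1 :=
      mul_left_cancel₀ (norm_ne_zero_iff.2 hea) (by rw [← dae, mul_one])
    have h3 : ‖1 - (m : ℂ) * E x‖ ^ 2 = 1 := by rw [h2]; norm_num
    rw [← Complex.normSq_eq_norm_sq, Complex.normSq_apply] at h3
    simp only [Complex.sub_re, Complex.sub_im, Complex.re_ofReal_mul, Complex.im_ofReal_mul, E_re, E_im,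
        Complex.one_re, Complex.one_im] at h3
    apply mul_left_cancel₀ hm.ne'
    linear_combination h3 - m ^ 2 * Real.sin_sq_add_cos_sq x
  have hid : ∀ x : ℝ, 1 - ((2 * Real.cos x : ℝ) : ℂ) * E x = E (π + 2 * x) := by
    intro x
    apply Complex.ext
    · simp only [Complex.sub_re, Complex.re_ofReal_mul, E_re, Complex.one_re]
      rw [add_comm, Real.cos_add_pi, Real.cos_two_mul]; ring
    · simp only [Complex.sub_im, Complex.im_ofReal_mul, E_im, Complex.one_im]
      rw [add_comm, Real.sin_add_pi, Real.sin_two_mul]; ring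
  obtain ⟨m, hm0, h | h⟩ := of_angle (u := a - e) (v := f - e) hang2 hae hfe
  · exfalso
    have hmv := hm _ _ hm0 h
    subst hmv
    have hfa : f - a = s * ((Real.sin (π / 3) : ℂ) * E (φ + 2 * α - 5 * π / 3)) := by
      have : f - a = (e - a) * (1 - ((2 * Real.cos α : ℝ) : ℂ) * E α) := by linear_combination h
      rw [this, hid, hE', mul_assoc, mul_assoc, ← E_add,
        show φ - 2 * π / 3 + (π + 2 * α) = φ + 2 * α - 5 * π / 3 + 2 * π by ring, E_add _ (2 * π),
        E_two_pi, mul_one]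
    have hef : e2 - f = s * (((2 * Real.sin (π / 3) * Real.sin (7 * π / 6 - φ - α) : ℝ) : ℂ) * E α) := by
      have : e2 - f = s * ((Real.sin (π / 3) : ℂ) * E (2 * π / 3 - φ)
          - (Real.sin (π / 3) : ℂ) * E (φ + 2 * α - 5 * π / 3)) := by
        linear_combination hE2 - hfa
      rw [this, E_sub]
      congr 3
      · congr 3; ring
      · ring
    rcases lt_trichotomy (Real.sin (7 * π / 6 - φ - α)) 0 with hsn | hsn | hsn
    · have := turn_eq_s3 (p := f) (q := e2) (r := c2) (s := s)
        (k₁ := 2 * Real.sin (π / 3) * -Real.sin (7 * π / 6 - φ - α)) (k₂ := Real.sin φ)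
        (x := α + π) (y := π) (θ := -α) hs0 (mul_pos (by positivity) (by linarith)) hq
        (by rw [hef, E_add, E_pi]; push_cast; ring)
        (by rw [← hk15, hk1S] at he2
            rw [E_pi]; linear_combination -he2)
        (by congr 1; ring) (by linarith) (by linarith)
      linarith
    · rw [hsn, mul_zero, Complex.ofReal_zero, zero_mul, mul_zero] at hef
      exact m4 (sub_eq_zero.1 hef).symm
    · have := turn_eq_s3 (p := e) (q := f) (r := e2) (s := s) (k₁ := 2 * Real.cos α * Real.sin (π / 3))
        (k₂ := 2 * Real.sin (π / 3) * Real.sin (7 * π / 6 - φ - α)) (x := φ + π / 3 + α) (y := α)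
        (θ := -φ - π / 3) hs0 (by positivity) (by positivity)
        (by
          rw [h, ← neg_sub, hE', show φ + π / 3 + α = α + (φ - 2 * π / 3) + π by ring, E_add _ π, E_pi,
            E_add]
          push_cast; ring)
        hef (by congr 1; ring) (by linarith) (by linarith)
      linarith
  · have hmv := hm _ _ hm0 h
    subst hmv
    refine ⟨s, hs0, hs, hE', ?_, hE2, hc2⟩
    have : f - a = (e - a) * (1 - ((2 * Real.cos (-α) : ℝ) : ℂ) * E (-α)) := by linear_combination h
    rw [this, hid, hE', mul_assoc, mul_assoc, ← E_add]
    congr 3; ring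

end main

/-- For any `φ, α` with `0 < φ < 2π/3`, `0 < α < π/2` and
`φ − π/6 < α < φ + π/3` there is a 4-special polygon with angle parameters
`φ` and `α`, and any other 4-special polygon with the same angle parameters is
directly similar to it (an orientation-preserving similarity of the plane
`z ↦ s·z + t`, `s ≠ 0`, carries corresponding vertices to each other). -/
theorem four_special_exists_unique (φ α : ℝ)
    (hφ₀ : 0 < φ) (hφ₁ : φ < 2 * π / 3) (hα₀ : 0 < α) (hα₁ : α < π / 2)
    (h₀ : φ - π / 6 < α) (h₁ : α < φ + π / 3) :
    ∃ a c' e' f' e'' c'' : ℂ, Is4Special a c' e' f' e'' c'' ∧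
      EuclideanGeometry.angle c' a e' = φ ∧ EuclideanGeometry.angle a e' f' = α ∧
      ∀ a₁ c₁' e₁' f₁' e₁'' c₁'' : ℂ, Is4Special a₁ c₁' e₁' f₁' e₁'' c₁'' →
        EuclideanGeometry.angle c₁' a₁ e₁' = φ → EuclideanGeometry.angle a₁ e₁' f₁' = α →
        ∃ s t : ℂ, s ≠ 0 ∧ a₁ = s * a + t ∧ c₁' = s * c' + t ∧ e₁' = s * e' + t ∧
          f₁' = s * f' + t ∧ e₁'' = s * e'' + t ∧ c₁'' = s * c'' + t := by
  obtain ⟨hP, hA, hB⟩ := exists_part φ α hφ₀ hφ₁ hα₀ hα₁ h₀ h₁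
  refine ⟨_, _, _, _, _, _, hP, hA, hB, ?_⟩
  intro a c e f e2 c2 H H1 H2
  obtain ⟨s, hs, h1, h2, h3, h4, h5⟩ := unique_part φ α hφ₀ hφ₁ hα₀ hα₁ a c e f e2 c2 H H1 H2
  refine ⟨s, a, hs, by ring, ?_, ?_, ?_, ?_, ?_⟩
  · rw [← h1]; ring
  · rw [← h2]; ring
  · rw [← h3]; ring
  · rw [← h4]; ring
  · rw [← h5]; ring
end

section
/- For every 3-special polygon P with angle parameters φ = φ(P) and α = α(P), the following hold: (1) π/6 < φ < 2π/3; (2) α = φ − π/6. -/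
open Real EuclideanGeometry

attribute [local instance] Complex.finrank_real_complex_fact

lemma turn_rot (p q r : ℂ) (θ : ℝ) (h : turn p q r = θ) (hpq : p ≠ q) (hqr : q ≠ r) :
    ∃ k : ℝ, 0 < k ∧ k * dist p q = dist q r ∧
      r - q = k * (Real.cos θ + Real.sin θ * Complex.I) * (q - p) := by
  have hw : q - p ≠ 0 := sub_ne_zero.2 hpq.symm
  have hz : r - q ≠ 0 := sub_ne_zero.2 hqr.symm
  have hd1 : dist p q = ‖q - p‖ := by rw [dist_comm, dist_eq_norm]
  have hd2 : dist q r = ‖r - q‖ := by rw [dist_comm, dist_eq_norm]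
  rw [hd1, hd2]
  unfold turn at h
  rw [Complex.oangle, Complex.arg_coe_angle_toReal_eq_arg] at h
  generalize q - p = w at *
  generalize r - q = z at *
  have hw' : 0 < ‖w‖ := norm_pos_iff.2 hw
  have hz' : 0 < ‖z‖ := norm_pos_iff.2 hz
  refine ⟨‖z‖ / ‖w‖, by positivity, by field_simp, ?_⟩
  have h1 := Complex.norm_mul_cos_add_sin_mul_I ((starRingEnd ℂ) w * z)
  rw [h, norm_mul, Complex.norm_conj] at h1
  have hwc : (‖w‖ : ℂ) ≠ 0 := by exact_mod_cast hw'.ne'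
  have h2 : w * (starRingEnd ℂ) w = (‖w‖ : ℂ) ^ 2 := by
    rw [Complex.mul_conj, Complex.normSq_eq_norm_sq]; push_cast; rfl
  have h3 : (‖w‖ : ℂ) ^ 2 * z = ‖w‖ * ‖z‖ * (Complex.cos θ + Complex.sin θ * Complex.I) * w := by
    rw [← h2]; push_cast at h1; linear_combination -w * h1
  push_cast
  field_simp
  apply mul_left_cancel₀ hwc
  linear_combination h3

lemma angle_facts (ρ : ℝ) (hρ : 1 / 2 < ρ) (z w : ℂ)
    (hz : z = ⟨1 - ρ / 2, ρ * √3 / 2⟩) (hw : w = ⟨3 / 2, √3 / 2⟩) :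
    (π / 6 < InnerProductGeometry.angle 1 z ∧ InnerProductGeometry.angle 1 z < 2 * π / 3) ∧
      InnerProductGeometry.angle z w = InnerProductGeometry.angle 1 z - π / 6 := by
  have hpi := Real.pi_pos
  have h3 : √3 * √3 = 3 := Real.mul_self_sqrt (by norm_num)
  have h3p : 0 < √3 := by positivity
  have him : 0 < z.im := by rw [hz]; dsimp only; positivity
  have hz0 : z ≠ 0 := by rintro rfl; simp at him
  have hn : 0 < ‖z‖ := norm_pos_iff.2 hz0
  have hw0 : w ≠ 0 := by
    rintro rfl
    have := congrArg Complex.re hw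
    norm_num at this
  have ha0 : 0 ≤ z.arg := Complex.arg_nonneg_iff.2 him.le
  have hapi : z.arg ≤ π := Complex.arg_le_pi z
  have hc : ‖z‖ * Real.cos z.arg = 1 - ρ / 2 := by
    rw [Complex.norm_mul_cos_arg, hz]
  have hs : ‖z‖ * Real.sin z.arg = ρ * √3 / 2 := by
    rw [Complex.norm_mul_sin_arg, hz]
  have hc6 := Real.cos_pi_div_six
  have hs6 := Real.sin_pi_div_six
  have hang : InnerProductGeometry.angle 1 z = z.arg := by
    rw [InnerProductGeometry.angle_comm, Complex.angle_eq_abs_arg hz0 one_ne_zero, div_one,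
      abs_of_nonneg ha0]
  have hsin1 : 0 < Real.sin (z.arg - π / 6) := by
    have : ‖z‖ * Real.sin (z.arg - π / 6) = ρ - 1 / 2 := by
      rw [Real.sin_sub, hc6, hs6]
      linear_combination (√3 / 2) * hs - (1 / 2) * hc + ρ / 4 * h3
    exact pos_of_mul_pos_right (by rw [this]; linarith) hn.le
  have hgt : π / 6 < z.arg := by
    by_contra hcon
    have := Real.sin_nonpos_of_nonpos_of_neg_pi_le (x := z.arg - π / 6) (by linarith) (by linarith)
    linarith
  have hcos1 : 0 < Real.cos (z.arg - π / 6) := by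
    have : ‖z‖ * Real.cos (z.arg - π / 6) = √3 / 2 := by
      rw [Real.cos_sub, hc6, hs6]
      linear_combination (√3 / 2) * hc + (1 / 2) * hs
    exact pos_of_mul_pos_right (by rw [this]; positivity) hn.le
  have hlt : z.arg < 2 * π / 3 := by
    by_contra hcon
    have := Real.cos_nonpos_of_pi_div_two_le_of_le (x := z.arg - π / 6) (by linarith) (by linarith)
    linarith
  rw [hang]
  refine ⟨⟨hgt, hlt⟩, ?_⟩
  have hq : z / w = ((‖z‖ / √3 : ℝ) : ℂ) *
      (Complex.cos ((z.arg - π / 6 : ℝ) : ℂ) + Complex.sin ((z.arg - π / 6 : ℝ) : ℂ) * Complex.I) := by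
    rw [div_eq_iff hw0, ← Complex.ofReal_cos, ← Complex.ofReal_sin, Real.cos_sub, Real.sin_sub,
      hc6, hs6, hw]
    apply Complex.ext
    · have hh : ‖z‖ * (Complex.cos (z.arg : ℂ)).re = z.re := Complex.norm_mul_cos_arg z
      simp
      field_simp
      ring_nf
      simp only [show √3 ^ 2 = 3 by rw [sq, h3]]
      linear_combination -4 * √3 * hh
    · have hh : ‖z‖ * (Complex.sin (z.arg : ℂ)).re = z.im := Complex.norm_mul_sin_arg z
      simp
      field_simp
      ring_nf
      simp only [show √3 ^ 2 = 3 by rw [sq, h3]]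
      linear_combination -4 * √3 * hh
  rw [Complex.angle_eq_abs_arg hz0 hw0, hq,
    Complex.arg_mul_cos_add_sin_mul_I (by positivity) ⟨by linarith, by linarith⟩,
    abs_of_nonneg (by linarith)]

/-- For every 3-special polygon with angle parameters `φ = ∠c'ae'` and
`α = ∠ae'e''` one has `π/6 < φ < 2π/3` and `α = φ − π/6`. -/
theorem three_special_angle_parameters (a c' e' e'' c'' : ℂ)
    (h : Is3Special a c' e' e'' c'')
    (φ α : ℝ) (hφ : φ = EuclideanGeometry.angle c' a e')
    (hα : α = EuclideanGeometry.angle a e' e'') :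
    (π / 6 < φ ∧ φ < 2 * π / 3) ∧ α = φ - π / 6 := by
  obtain ⟨⟨hne, -, hdis⟩, -, h0, -, h1, h4, hd, -, hd', h2, h3⟩ := h
  have n0 : a ≠ c' := hne 0
  have n1 : c' ≠ e' := hne 1
  have n2 : e' ≠ e'' := hne 2
  have n3 : e'' ≠ c'' := hne 3
  have n4 : c'' ≠ a := hne 4
  have hdis := hdis 0 2 (by decide) (by decide) (by decide)
  change segment ℝ a c' ∩ segment ℝ e' e'' = ∅ at hdis
  change π - turn c'' a c' = _ at h0
  change π - turn a c' e' = _ at h1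
  change π - turn c' e' e'' = _ at h2
  change π - turn e' e'' c'' = _ at h3
  have s3 : √3 * √3 = 3 := Real.mul_self_sqrt (by norm_num)
  have s3c : (√3 : ℂ) * √3 = 3 := by exact_mod_cast s3
  have hI := Complex.I_mul_I
  obtain ⟨k0, k0p, k0d, e0⟩ := turn_rot c'' a c' (-(π / 3)) (by linarith) n4 n0
  obtain ⟨ρ, ρp, ρd, e1⟩ := turn_rot a c' e' (π - π / 3) (by linarith) n0 n1
  obtain ⟨k2, k2p, k2d, e2⟩ := turn_rot c' e' e'' (π / 2) (by linarith) n1 n2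
  obtain ⟨k3, k3p, k3d, e3⟩ := turn_rot e' e'' c'' (π / 2) (by linarith) n2 n3
  have k01 : k0 = 1 := by
    have := dist_pos.2 n4
    rw [hd, dist_comm a c''] at k0d
    exact mul_right_cancel₀ this.ne' (by linarith)
  have k321 : k3 * k2 = 1 := by
    have := dist_pos.2 n1
    rw [dist_comm e'' c'', ← hd', ← k2d] at k3d
    exact mul_right_cancel₀ this.ne' (by linarith)
  have k321c : (k3 : ℂ) * k2 = 1 := by exact_mod_cast k321
  rw [Real.cos_neg, Real.sin_neg, Real.cos_pi_div_three, Real.sin_pi_div_three, k01] at e0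
  rw [Real.cos_pi_sub, Real.sin_pi_sub, Real.cos_pi_div_three, Real.sin_pi_div_three] at e1
  rw [Real.cos_pi_div_two, Real.sin_pi_div_two] at e2 e3
  push_cast at e0 e1 e2 e3
  have hu : c' - a ≠ 0 := sub_ne_zero.2 n0.symm
  have E1 : e' - a = (c' - a) * ⟨1 - ρ / 2, ρ * √3 / 2⟩ := by
    rw [Complex.mk_eq_add_mul_I]; push_cast
    linear_combination e1
  have E3 : c'' - e'' = -(e' - c') := by
    rw [e3, e2]
    linear_combination (e' - c') * (k3 * k2 * hI - k321c)
  have E0 : c'' - a = (c' - a) * (-(1 / 2) - √3 / 2 * Complex.I) := by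
    linear_combination (-(1 / 2) - √3 / 2 * Complex.I) * (-e0)
      + (c'' - a) * (Complex.I ^ 2 / 4 * s3c + 3 / 4 * hI)
  have E2 : e'' - e' = -((c' - a) * ⟨3 / 2, √3 / 2⟩) := by
    rw [Complex.mk_eq_add_mul_I]; push_cast
    linear_combination E0 - E3
  have hρ : 1 / 2 < ρ := by
    by_contra hcon
    have hmem : a + ((1 - 2 * ρ : ℝ) : ℂ) * (c' - a) ∈ segment ℝ a c' ∩ segment ℝ e' e'' := by
      constructor
      · rw [segment_eq_image']
        exact ⟨1 - 2 * ρ, ⟨by linarith, by linarith⟩, by simp⟩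
      · rw [segment_eq_image']
        refine ⟨ρ, ⟨by linarith, by linarith⟩, ?_⟩
        simp only [Complex.real_smul]
        rw [E2]
        rw [Complex.mk_eq_add_mul_I] at E1 ⊢
        push_cast at E1 ⊢
        linear_combination E1
    rw [hdis] at hmem
    exact hmem
  have key := angle_facts ρ hρ _ _ rfl rfl
  have hφ' : φ = InnerProductGeometry.angle 1 (⟨1 - ρ / 2, ρ * √3 / 2⟩ : ℂ) := by
    rw [hφ, EuclideanGeometry.angle, vsub_eq_sub, vsub_eq_sub, E1,
      ← Complex.angle_mul_left hu 1, mul_one]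
  have hα' : α = InnerProductGeometry.angle (⟨1 - ρ / 2, ρ * √3 / 2⟩ : ℂ) ⟨3 / 2, √3 / 2⟩ := by
    rw [hα, EuclideanGeometry.angle, vsub_eq_sub, vsub_eq_sub, E2, ← neg_sub e' a, E1,
      InnerProductGeometry.angle_neg_neg, Complex.angle_mul_left hu]
  rw [hφ', hα']
  exact key
end

section
/- For every 2-special polygon P with angle parameters φ = φ(P) and α = α(P), the following hold: (1) φ = 0; (2) 0 < α < π/3. -/
open Real EuclideanGeometry

attribute [local instance] Complex.finrank_real_complex_fact

theorem turn_ne_pi (p q r : ℂ) (hs : segment ℝ p q ∩ segment ℝ q r = {q})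
    (hpq : p ≠ q) (hqr : q ≠ r) : turn p q r ≠ π := by
  intro h
  have h1 : InnerProductGeometry.angle (q - p) (r - q) = π := by
    rw [Complex.orientation.angle_eq_abs_oangle_toReal (sub_ne_zero.2 hpq.symm)
      (sub_ne_zero.2 hqr.symm)]
    unfold turn at h
    rw [h, abs_of_pos Real.pi_pos]
  obtain ⟨-, s, hs0, hsr⟩ := InnerProductGeometry.angle_eq_pi_iff.1 h1
  have hr : r = q + s • (q - p) := by rw [← hsr]; ring
  rcases le_total (-1) s with h2 | h2
  · have : r ∈ segment ℝ p q ∩ segment ℝ q r := by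
      refine ⟨⟨-s, 1 + s, by linarith, by linarith, by ring, ?_⟩, right_mem_segment ℝ q r⟩
      rw [hr]; simp only [Complex.real_smul]; push_cast; ring
    rw [hs] at this
    exact hqr this.symm
  · have : p ∈ segment ℝ p q ∩ segment ℝ q r := by
      refine ⟨left_mem_segment ℝ p q, ⟨1 + s⁻¹, -s⁻¹, ?_, ?_, by ring, ?_⟩⟩
      · have : s * s⁻¹ = 1 := mul_inv_cancel₀ hs0.ne
        have h3 : s⁻¹ < 0 := inv_lt_zero.2 hs0
        nlinarith
      · have h3 : s⁻¹ < 0 := inv_lt_zero.2 hs0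
        linarith
      · have : (s : ℂ) ≠ 0 := by exact_mod_cast hs0.ne
        rw [hr]; simp only [Complex.real_smul]; push_cast; field_simp; ring
    rw [hs] at this
    exact hpq this

theorem turn_le_pi (p q r : ℂ) : turn p q r ≤ π := Real.Angle.toReal_le_pi _

theorem angle_eq_of_turn_pos (p q r : ℂ) (hpq : p ≠ q) (hqr : q ≠ r) (h : 0 < turn p q r) :
    EuclideanGeometry.angle p q r = π - turn p q r := by
  have h1 : InnerProductGeometry.angle (q - p) (r - q) = turn p q r := by
    rw [Complex.orientation.angle_eq_abs_oangle_toReal (sub_ne_zero.2 hpq.symm)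
      (sub_ne_zero.2 hqr.symm)]
    exact abs_of_pos h
  rw [← h1, ← InnerProductGeometry.angle_neg_left, neg_sub]
  rfl

/-- For every 2-special polygon, its angle parameters `φ = 0` and
`α = ∠ac'd` satisfy `φ = 0` and `0 < α < π/3`. -/
theorem two_special_angle_parameters (a c' d c'' : ℂ)
    (h : Is2Special a c' d c'')
    (φ α : ℝ) (hφ : φ = 0) (hα : α = EuclideanGeometry.angle a c' d) :
    φ = 0 ∧ (0 < α ∧ α < π / 3) := by
  obtain ⟨⟨hne, hcons, -⟩, hccw, h0, h1, h3, h2, -, -⟩ := h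
  have n1 : a ≠ c' := hne 0
  have n2 : c' ≠ d := hne 1
  have n3 : d ≠ c'' := hne 2
  have n4 : c'' ≠ a := hne 3
  have s1 : segment ℝ a c' ∩ segment ℝ c' d = {c'} := hcons 0
  have s3 : segment ℝ d c'' ∩ segment ℝ c'' a = {c''} := hcons 2
  have t0 : π - turn c'' a c' = 4 * π / 3 := h0
  have t1 : π - turn a c' d < π := h1
  have t2 : π - turn c' d c'' = π / 3 := h2
  have t3 : π - turn d c'' a < π := h3
  have hsum : turn c'' a c' + turn a c' d + turn c' d c'' + turn d c'' a = 2 * π := by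
    have := hccw
    unfold IsCCW at this
    rw [Fin.sum_univ_four] at this
    exact this
  have l1 := lt_of_le_of_ne (turn_le_pi a c' d) (turn_ne_pi a c' d s1 n1 n2)
  have l3 := lt_of_le_of_ne (turn_le_pi d c'' a) (turn_ne_pi d c'' a s3 n3 n4)
  rw [hα, angle_eq_of_turn_pos a c' d n1 n2 (by linarith)]
  exact ⟨hφ, by linarith, by linarith⟩
end

section
/- For every 4-special polygon P with angle parameters φ = φ(P), α = α(P) and β = β(P), one has α + β = φ + π/3. -/
open Real EuclideanGeometry

attribute [local instance] Complex.finrank_real_complex_fact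

/-- Unit complex number with argument `t`. -/
noncomputable def fsE (t : ℝ) : ℂ := Complex.exp ((t : ℂ) * Complex.I)

lemma fsE_add (s t : ℝ) : fsE (s + t) = fsE s * fsE t := by
  unfold fsE; rw [← Complex.exp_add]; push_cast; ring_nf

lemma fsE_re (t : ℝ) : (fsE t).re = cos t := by
  unfold fsE; exact Complex.exp_ofReal_mul_I_re t

lemma fsE_im (t : ℝ) : (fsE t).im = sin t := by
  unfold fsE; exact Complex.exp_ofReal_mul_I_im t

lemma fsE_norm (t : ℝ) : ‖fsE t‖ = 1 := by
  unfold fsE; exact Complex.norm_exp_ofReal_mul_I t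

lemma fsE_ne (t : ℝ) : fsE t ≠ 0 := by
  unfold fsE; exact Complex.exp_ne_zero _

lemma fsE_zero : fsE 0 = 1 := by simp [fsE]

lemma fsE_pi : fsE π = -1 := by simp [fsE]

lemma fsE_half : fsE (π / 2) = Complex.I := by
  apply Complex.ext <;> simp [fsE_re, fsE_im]

lemma fsE_two_pi : fsE (2 * π) = 1 := by
  apply Complex.ext <;> simp [fsE_re, fsE_im]

lemma fsE_conj (t : ℝ) : (starRingEnd ℂ) (fsE t) = fsE (-t) := by
  apply Complex.ext <;> simp [fsE_re, fsE_im]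

lemma fs_norm_mul_arg (z : ℂ) : z = (‖z‖ : ℂ) * fsE (Complex.arg z) := by
  unfold fsE; exact (Complex.norm_mul_exp_arg_mul_I z).symm

lemma fsE_sub (x t : ℝ) :
    fsE t - fsE x = ((2 * sin ((t - x) / 2) : ℝ) : ℂ) * fsE (π / 2 + (t + x) / 2) := by
  have h1 : t = (t + x) / 2 + (t - x) / 2 := by ring
  have h2 : x = (t + x) / 2 + -((t - x) / 2) := by ring
  generalize (t + x) / 2 = p at *
  generalize (t - x) / 2 = q at *
  subst h1
  rw [fsE_add, fsE_add, fsE_half, h2, fsE_add p (-q), ← mul_sub]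
  have : fsE q - fsE (-q) = ((2 * sin q : ℝ) : ℂ) * Complex.I := by
    apply Complex.ext
    · rw [Complex.re_ofReal_mul]; simp [fsE_re]
    · rw [Complex.im_ofReal_mul]; simp [fsE_im]; ring
  rw [this]; ring

lemma fs_turn (p q r : ℂ) :
    turn p q r = Complex.arg ((starRingEnd ℂ) (q - p) * (r - q)) := by
  unfold turn
  rw [Complex.oangle, Real.Angle.toReal_coe_eq_self_iff]
  exact ⟨Complex.neg_pi_lt_arg _, Complex.arg_le_pi _⟩

lemma fs_of_turn {w z : ℂ} {t : ℝ} (hw : w ≠ 0)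
    (h : Complex.arg ((starRingEnd ℂ) w * z) = t) :
    z = ((‖z‖ / ‖w‖ : ℝ) : ℂ) * w * fsE t := by
  have h1 := fs_norm_mul_arg ((starRingEnd ℂ) w * z)
  rw [h] at h1
  have hw' : (starRingEnd ℂ) w ≠ 0 := by simpa using hw
  have hn : (‖w‖ : ℂ) ≠ 0 := by simpa using hw
  have h2 : (starRingEnd ℂ) w * w = (‖w‖ : ℂ) ^ 2 := by
    rw [mul_comm, Complex.mul_conj, Complex.normSq_eq_norm_sq]; push_cast; rfl
  apply mul_left_cancel₀ hw'
  rw [h1]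
  push_cast
  rw [norm_mul, RCLike.norm_conj]
  push_cast
  have : (starRingEnd ℂ) w * ((‖z‖ : ℂ) / ‖w‖ * w * fsE t)
      = ((starRingEnd ℂ) w * w) * ((‖z‖ : ℂ) / ‖w‖) * fsE t := by ring
  rw [this, h2]
  field_simp

lemma fs_cross {U w z : ℂ} (hU : U ≠ 0) {r q p t : ℝ}
    (h : 0 < Complex.arg ((starRingEnd ℂ) w * z))
    (hw : w = U * ((r : ℂ) * fsE p)) (hz : z = U * ((q : ℂ) * fsE t)) :
    0 ≤ r * q * sin (t - p) := by
  have h1 : 0 ≤ ((starRingEnd ℂ) w * z).im := Complex.arg_nonneg_iff.mp h.le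
  have h2 : (starRingEnd ℂ) w * z = ((Complex.normSq U * (r * q) : ℝ) : ℂ) * fsE (t - p) := by
    rw [hw, hz, sub_eq_add_neg, fsE_add, ← fsE_conj]
    push_cast
    rw [Complex.normSq_eq_conj_mul_self]
    simp only [map_mul, Complex.conj_ofReal]
    ring
  rw [h2, Complex.im_ofReal_mul, fsE_im] at h1
  have h3 : 0 < Complex.normSq U := Complex.normSq_pos.mpr hU
  by_contra hc
  push Not at hc
  nlinarith

lemma fs_arg {r t : ℝ} (hr : 0 < r) (h1 : -π < t) (h2 : t ≤ π) :
    Complex.arg ((r : ℂ) * fsE t) = t := by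
  rw [Complex.arg_real_mul _ hr]
  unfold fsE
  rw [Complex.arg_exp_mul_I, toIocMod_eq_self]
  constructor <;> linarith

lemma fs_exists_angle {z : ℂ} (h : ‖z‖ = 1) : ∃ x : ℝ, 0 ≤ x ∧ x < 2 * π ∧ z = fsE x := by
  have h1 := fs_norm_mul_arg z
  rw [h] at h1
  have h2 := Complex.neg_pi_lt_arg z
  have h3 := Complex.arg_le_pi z
  have hp := Real.pi_pos
  by_cases h0 : 0 ≤ Complex.arg z
  · exact ⟨_, h0, by linarith, by simpa using h1⟩
  · refine ⟨Complex.arg z + 2 * π, by linarith, by linarith, ?_⟩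
    rw [fsE_add, fsE_two_pi]; simpa using h1

lemma fs_angle {a p q : ℂ} {r t : ℝ} (hp : p ≠ a) (hr : 0 < r) (h1 : -π < t) (h2 : t ≤ π)
    (h : q - a = (p - a) * ((r : ℂ) * fsE t)) :
    EuclideanGeometry.angle p a q = |t| := by
  have hp' : p - a ≠ 0 := sub_ne_zero.mpr hp
  have hq' : q - a ≠ 0 := by
    rw [h]
    exact mul_ne_zero hp' (mul_ne_zero (by exact_mod_cast hr.ne') (fsE_ne t))
  unfold EuclideanGeometry.angle
  rw [InnerProductGeometry.angle_comm]
  simp only [vsub_eq_sub]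
  rw [Complex.angle_eq_abs_arg hq' hp', h, mul_div_cancel_left₀ _ hp', fs_arg hr h1 h2]

theorem four_special_angle_sum (a c' e' f' e'' c'' : ℂ)
    (h : Is4Special a c' e' f' e'' c'')
    (φ α β : ℝ) (hφ : φ = EuclideanGeometry.angle c' a e')
    (hα : α = EuclideanGeometry.angle a e' f')
    (hβ : β = EuclideanGeometry.angle a e'' f') :
    α + β = φ + π / 3 := by
  have hpi := Real.pi_pos
  obtain ⟨⟨hne, -, -⟩, -, hA, hlt, hC1, hC2, hac, -, hce, haf, hae⟩ := h
  have n0 : a ≠ c' := hne 0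
  have n1 : c' ≠ e' := hne 1
  have n2 : e' ≠ f' := hne 2
  have n3 : f' ≠ e'' := hne 3
  have n4 : e'' ≠ c'' := hne 4
  have n5 : c'' ≠ a := hne 5
  have t0 : π - turn c'' a c' = 4 * π / 3 := hA
  have t1 : π - turn a c' e' = π / 3 := hC1
  have t2 : π - turn c' e' f' < π := hlt 2 (by decide)
  have t3 : π - turn e' f' e'' < π := hlt 3 (by decide)
  have t4 : π - turn f' e'' c'' < π := hlt 4 (by decide)
  have t5 : π - turn e'' c'' a = π / 3 := hC2
  rw [fs_turn] at t0 t1 t2 t3 t4 t5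
  clear hne hA hlt hC1 hC2
  obtain ⟨U, hUdef⟩ : ∃ U, U = c'' - a := ⟨_, rfl⟩
  have hU : U ≠ 0 := by rw [hUdef]; exact sub_ne_zero.mpr n5
  have hUn : 0 < ‖U‖ := norm_pos_iff.mpr hU
  obtain ⟨s, hs⟩ : ∃ s, s = ‖e' - c'‖ / ‖U‖ := ⟨_, rfl⟩
  have hs0 : 0 < s := by
    rw [hs]; exact div_pos (norm_pos_iff.mpr (sub_ne_zero.mpr n1.symm)) hUn
  have hn1 : ‖c' - a‖ = ‖U‖ := by
    rw [hUdef, ← dist_eq_norm, ← dist_eq_norm, dist_comm c', dist_comm c'']; exact hac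
  -- the basic points
  have E3 : fsE (-(π / 3)) = - fsE (2 * π / 3) := by
    have : 2 * π / 3 = π + -(π / 3) := by ring
    rw [this, fsE_add, fsE_pi]; ring
  have pc : c' - a = U * fsE (2 * π / 3) := by
    have := fs_of_turn (t := -(π / 3)) (sub_ne_zero.mpr n5.symm)
      (by linarith : Complex.arg ((starRingEnd ℂ) (a - c'') * (c' - a)) = -(π / 3))
    rw [norm_sub_rev a c'', ← hUdef, hn1, div_self hUn.ne', E3] at this
    rw [this, hUdef]; push_cast; ring
  have pe : e' - c' = U * ((s : ℂ) * fsE (4 * π / 3)) := by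
    have := fs_of_turn (t := 2 * π / 3) (sub_ne_zero.mpr n0.symm)
      (by linarith : Complex.arg ((starRingEnd ℂ) (c' - a) * (e' - c')) = 2 * π / 3)
    rw [hn1, ← hs, pc] at this
    rw [this, show 4 * π / 3 = 2 * π / 3 + 2 * π / 3 by ring, fsE_add]; ring
  have pe2 : c'' - e'' = U * ((s : ℂ) * fsE (π / 3)) := by
    have := fs_of_turn (t := 2 * π / 3) (sub_ne_zero.mpr n4.symm)
      (by linarith : Complex.arg ((starRingEnd ℂ) (c'' - e'') * (a - c'')) = 2 * π / 3)
    have hn : ‖c'' - e''‖ = ‖e' - c'‖ := by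
      rw [← dist_eq_norm, ← dist_eq_norm, dist_comm e' c']; exact hce.symm
    rw [norm_sub_rev a c'', ← hUdef, hn, show a - c'' = -U by rw [hUdef]; ring] at this
    have hsi : ‖U‖ / ‖e' - c'‖ = s⁻¹ := by rw [hs, inv_div]
    rw [hsi] at this
    have hE : fsE (2 * π / 3) * fsE (π / 3) = -1 := by
      rw [← fsE_add, ← fsE_pi]; congr 1; ring
    have hsc : (s : ℂ) ≠ 0 := by exact_mod_cast hs0.ne'
    have h2 : U = -(((s⁻¹ : ℝ) : ℂ) * (c'' - e'') * fsE (2 * π / 3)) := by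
      rw [← this]; ring
    rw [h2]
    push_cast
    have : -((s : ℂ)⁻¹ * (c'' - e'') * fsE (2 * π / 3)) * ((s : ℂ) * fsE (π / 3))
      = -((s : ℂ)⁻¹ * s) * (c'' - e'') * (fsE (2 * π / 3) * fsE (π / 3)) := by ring
    rw [this, hE, inv_mul_cancel₀ hsc]; ring
  -- polar form
  obtain ⟨z, hz⟩ : ∃ z, z = 1 + (s : ℂ) * fsE (2 * π / 3) := ⟨_, rfl⟩
  have hsin : 0 < sin (2 * π / 3) := Real.sin_pos_of_pos_of_lt_pi (by linarith) (by linarith)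
  have hzim : 0 < z.im := by
    rw [hz]; simp [fsE_im]; positivity
  have hz0 : z ≠ 0 := by rintro rfl; simp at hzim
  obtain ⟨R, hR⟩ : ∃ R, R = ‖z‖ := ⟨_, rfl⟩
  have hR0 : 0 < R := by rw [hR]; exact norm_pos_iff.mpr hz0
  obtain ⟨ψ, hψ⟩ : ∃ ψ, ψ = Complex.arg z := ⟨_, rfl⟩
  have hzp : z = (R : ℂ) * fsE ψ := by rw [hR, hψ]; exact fs_norm_mul_arg z
  have hψ0 : 0 < ψ := by
    rw [hψ]
    refine lt_of_le_of_ne (Complex.arg_nonneg_iff.mpr hzim.le) ?_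
    intro h0
    have := Complex.arg_eq_zero_iff.mp h0.symm
    linarith [this.2]
  have hψpi : ψ ≤ π := by rw [hψ]; exact Complex.arg_le_pi z
  have hψ2 : ψ < 2 * π / 3 := by
    by_contra hc
    push Not at hc
    have h1 : z * fsE (-(2 * π / 3)) = (s : ℂ) + fsE (-(2 * π / 3)) := by
      rw [hz, add_mul, mul_assoc, ← fsE_add, add_neg_cancel, fsE_zero]; ring
    rw [hzp, mul_assoc, ← fsE_add] at h1
    have h2 := congrArg Complex.im h1
    simp only [Complex.im_ofReal_mul, Complex.add_im, Complex.ofReal_im, fsE_im, Real.sin_neg] at h2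
    have h3 : 0 ≤ sin (ψ + -(2 * π / 3)) :=
      Real.sin_nonneg_of_nonneg_of_le_pi (by linarith) (by linarith)
    have := mul_nonneg hR0.le h3
    linarith
  have qe : e' - a = U * ((R : ℂ) * fsE (2 * π / 3 + ψ)) := by
    have : e' - a = (e' - c') + (c' - a) := by ring
    rw [this, pe, pc, show 4 * π / 3 = 2 * π / 3 + 2 * π / 3 by ring, fsE_add, fsE_add]
    linear_combination U * fsE (2 * π / 3) * (hzp - hz)
  have hzc : 1 + (s : ℂ) * fsE (-(2 * π / 3)) = (R : ℂ) * fsE (-ψ) := by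
    have := congrArg (starRingEnd ℂ) (hz.symm.trans hzp)
    simpa [fsE_conj] using this
  obtain ⟨T, hT⟩ : ∃ T, T = 4 * π / 3 - 2 * ψ := ⟨_, rfl⟩
  have qe2 : e'' - a = U * ((R : ℂ) * fsE (2 * π / 3 + ψ + T)) := by
    have h1 : e'' - a = U - (c'' - e'') := by rw [hUdef]; ring
    have h2 : fsE (-(2 * π / 3)) = - fsE (π / 3) := by
      have : π / 3 = π + -(2 * π / 3) := by ring
      rw [this, fsE_add, fsE_pi]; ring
    have h3 : 2 * π / 3 + ψ + T = 2 * π + -ψ := by rw [hT]; ring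
    rw [h3, fsE_add, fsE_two_pi, one_mul, ← hzc, h2, h1, pe2]; ring
  have hW : e' - a ≠ 0 := by
    rw [qe]
    exact mul_ne_zero hU (mul_ne_zero (by exact_mod_cast hR0.ne') (fsE_ne _))
  have hW2 : e'' - a ≠ 0 := by
    rw [qe2]
    exact mul_ne_zero hU (mul_ne_zero (by exact_mod_cast hR0.ne') (fsE_ne _))
  obtain ⟨x, hx0, hx2, hx⟩ : ∃ x : ℝ, 0 ≤ x ∧ x < 2 * π ∧ (f' - a) / (e' - a) = fsE x := by
    apply fs_exists_angle
    rw [norm_div, ← dist_eq_norm, ← dist_eq_norm, dist_comm f', dist_comm e', ← haf, div_self]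
    rw [dist_comm, dist_eq_norm]
    exact norm_ne_zero_iff.mpr hW
  have qf : f' - a = U * ((R : ℂ) * fsE (2 * π / 3 + ψ + x)) := by
    rw [div_eq_iff hW] at hx
    rw [hx, qe, fsE_add _ x]; ring
  -- differences
  have d1 : f' - e' = U * (((R * (2 * sin (x / 2)) : ℝ) : ℂ) *
      fsE (2 * π / 3 + ψ + π / 2 + x / 2)) := by
    have h1 : f' - e' = (f' - a) - (e' - a) := by ring
    have h2 := fsE_sub (2 * π / 3 + ψ) (2 * π / 3 + ψ + x)
    rw [show (2 * π / 3 + ψ + x - (2 * π / 3 + ψ)) / 2 = x / 2 by ring,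
      show π / 2 + (2 * π / 3 + ψ + x + (2 * π / 3 + ψ)) / 2
        = 2 * π / 3 + ψ + π / 2 + x / 2 by ring] at h2
    rw [h1, qf, qe, Complex.ofReal_mul]
    linear_combination U * R * h2
  have d2 : e'' - f' = U * (((R * (2 * sin ((T - x) / 2)) : ℝ) : ℂ) *
      fsE (2 * π / 3 + ψ + π / 2 + (T + x) / 2)) := by
    have h1 : e'' - f' = (e'' - a) - (f' - a) := by ring
    have h2 := fsE_sub (2 * π / 3 + ψ + x) (2 * π / 3 + ψ + T)
    rw [show (2 * π / 3 + ψ + T - (2 * π / 3 + ψ + x)) / 2 = (T - x) / 2 by ring,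
      show π / 2 + (2 * π / 3 + ψ + T + (2 * π / 3 + ψ + x)) / 2
        = 2 * π / 3 + ψ + π / 2 + (T + x) / 2 by ring] at h2
    rw [h1, qf, qe2, Complex.ofReal_mul]
    linear_combination U * R * h2
  -- orientation
  have k3 := fs_cross hU (by linarith) d1 d2
  have k2 := fs_cross hU (by linarith) pe d1
  have k4 := fs_cross hU (by linarith) d2 pe2
  have hsx : 0 < sin (x / 2) := by
    refine lt_of_le_of_ne (Real.sin_nonneg_of_nonneg_of_le_pi (by linarith) (by linarith)) ?_
    intro h0
    rw [← h0] at d1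
    simp at d1
    exact n2 (sub_eq_zero.mp d1).symm
  have hxpos : 0 < x := by
    rcases hx0.lt_or_eq with h | h
    · exact h
    · rw [← h] at hsx; simp at hsx
  have hsy0 : sin ((T - x) / 2) ≠ 0 := by
    intro h0
    rw [h0] at d2
    simp at d2
    exact n3 (sub_eq_zero.mp d2).symm
  have hsT : 0 < sin (T / 2) :=
    Real.sin_pos_of_pos_of_lt_pi (by rw [hT]; linarith) (by rw [hT]; linarith)
  rw [show 2 * π / 3 + ψ + π / 2 + (T + x) / 2 - (2 * π / 3 + ψ + π / 2 + x / 2) = T / 2 by ring]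
    at k3
  have hsy : 0 < sin ((T - x) / 2) := by
    refine lt_of_le_of_ne ?_ hsy0.symm
    by_contra hc
    push Not at hc
    have hpos : 0 < R * (2 * sin (x / 2)) * R * 2 * sin (T / 2) := by positivity
    nlinarith [mul_pos_of_neg_of_neg (neg_neg_of_pos hpos) hc]
  have hxT : x < T := by
    by_contra hc
    push Not at hc
    have : sin ((T - x) / 2) ≤ 0 :=
      Real.sin_nonpos_of_nonpos_of_neg_pi_le (by linarith) (by linarith)
    linarith
  have hxpi : x ≤ π := by
    by_contra hc
    push Not at hc
    have h1 : π / 3 - (2 * π / 3 + ψ + π / 2 + (T + x) / 2) = (π / 2 - x / 2) - 2 * π := by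
      rw [hT]; ring
    rw [h1, Real.sin_sub_two_pi] at k4
    have h2 : sin (π / 2 - x / 2) < 0 :=
      Real.sin_neg_of_neg_of_neg_pi_lt (by linarith) (by linarith)
    have hpos : 0 < R * (2 * sin ((T - x) / 2)) * s := by positivity
    linarith [mul_neg_of_pos_of_neg hpos h2]
  have hypi : T - x ≤ π := by
    by_contra hc
    push Not at hc
    have h1 : 2 * π / 3 + ψ + π / 2 + x / 2 - 4 * π / 3 = π / 2 - (T - x) / 2 := by
      rw [hT]; ring
    rw [h1] at k2
    have h2 : sin (π / 2 - (T - x) / 2) < 0 :=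
      Real.sin_neg_of_neg_of_neg_pi_lt (by linarith) (by linarith)
    have hpos : 0 < s * (R * (2 * sin (x / 2))) := by positivity
    linarith [mul_neg_of_pos_of_neg hpos h2]
  -- unoriented angles
  have r1 : EuclideanGeometry.angle c' a e' = |ψ| := by
    apply fs_angle n0.symm hR0 (by linarith) hψpi
    rw [qe, pc, fsE_add]; ring
  have r2 : EuclideanGeometry.angle a e' f' = |x / 2 - π / 2| := by
    apply fs_angle (r := 2 * sin (x / 2)) (sub_ne_zero.mp hW).symm (by positivity)
      (by linarith) (by linarith)
    rw [d1, show a - e' = -(e' - a) by ring, qe,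
      show 2 * π / 3 + ψ + π / 2 + x / 2 = (2 * π / 3 + ψ) + (π + (x / 2 - π / 2)) by ring,
      fsE_add _ (π + _), fsE_add π, fsE_pi]
    push_cast; ring
  have r3 : EuclideanGeometry.angle a e'' f' = |π / 2 - (T - x) / 2| := by
    apply fs_angle (r := 2 * sin ((T - x) / 2)) (sub_ne_zero.mp hW2).symm (by positivity)
      (by linarith) (by linarith)
    rw [show f' - e'' = -(e'' - f') by ring, d2, show a - e'' = -(e'' - a) by ring, qe2,
      show 2 * π / 3 + ψ + π / 2 + (T + x) / 2
        = (2 * π / 3 + ψ + T) + (π / 2 - (T - x) / 2) by ring,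
      fsE_add _ (π / 2 - _)]
    push_cast; ring
  rw [hα, hβ, hφ, r1, r2, r3, abs_of_pos hψ0, abs_of_nonpos (by linarith),
    abs_of_nonneg (by linarith), hT]
  ring
end

section
/- For every 3-special polygon P with angle parameters φ = φ(P), α = α(P) and β = β(P), one has α = β = φ − π/6. -/
open Real EuclideanGeometry

attribute [local instance] Complex.finrank_real_complex_fact

lemma turn_eq_imp (p q r : ℂ) (θ : ℝ) (h1 : p ≠ q) (h : turn p q r = θ) :
    r - q = ((‖r - q‖ / ‖q - p‖ : ℝ) : ℂ) * ((Real.cos θ : ℂ) + Real.sin θ * Complex.I) * (q - p) := by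
  have hx : q - p ≠ 0 := sub_ne_zero.mpr h1.symm
  unfold turn at h
  rw [Complex.oangle, Complex.arg_coe_angle_toReal_eq_arg] at h
  generalize q - p = x at *
  generalize r - q = y at *
  have h2 := Complex.norm_mul_cos_add_sin_mul_I ((starRingEnd ℂ) x * y)
  rw [h] at h2
  have hn : (‖x‖ : ℂ) ≠ 0 := by simpa using hx
  have h3 : (starRingEnd ℂ) x * x = (‖x‖ : ℂ) ^ 2 := Complex.conj_mul' x
  simp only [norm_mul, RCLike.norm_conj, Complex.ofReal_mul] at h2
  have hc : (starRingEnd ℂ) x ≠ 0 := by simpa using hx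
  push_cast
  apply mul_left_cancel₀ hc
  rw [← h2]
  field_simp
  linear_combination (-(‖y‖:ℂ) * ((Complex.cos θ : ℂ) + Complex.I * Complex.sin θ)) * h3

/-- For every 3-special polygon, with angle parameters `φ = ∠c'ae'`,
`α = ∠ae'e''` and `β = ∠ae''e'`, one has `α = β = φ − π/6`. -/
theorem three_special_angle_eq (a c' e' e'' c'' : ℂ)
    (h : Is3Special a c' e' e'' c'')
    (φ α β : ℝ) (hφ : φ = EuclideanGeometry.angle c' a e')
    (hα : α = EuclideanGeometry.angle a e' e'')
    (hβ : β = EuclideanGeometry.angle a e'' e') :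
    α = β ∧ α = φ - π / 6 := by
  obtain ⟨⟨hne, -, hdis⟩, -, -, -, h1, h4, hd, -, hd2, h2, h3⟩ := h
  have n0 : a ≠ c' := hne 0
  have n1 : c' ≠ e' := hne 1
  have n2 : e' ≠ e'' := hne 2
  have n3 : e'' ≠ c'' := hne 3
  have hdis : segment ℝ a c' ∩ segment ℝ e' e'' = ∅ :=
    hdis 0 2 (by decide) (by decide) (by decide)
  replace h1 : π - turn a c' e' = π / 3 := h1
  replace h2 : π - turn c' e' e'' = π / 2 := h2
  replace h3 : π - turn e' e'' c'' = π / 2 := h3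
  replace h4 : π - turn e'' c'' a = π / 3 := h4
  have t1 := turn_eq_imp a c' e' (π - π / 3) n0 (by linarith)
  have t2 := turn_eq_imp c' e' e'' (π / 2) n1 (by linarith)
  have t3 := turn_eq_imp e' e'' c'' (π / 2) n2 (by linarith)
  have t4 := turn_eq_imp e'' c'' a (π - π / 3) n3 (by linarith)
  rw [Real.cos_pi_sub, Real.sin_pi_sub, Real.cos_pi_div_three, Real.sin_pi_div_three] at t1 t4
  rw [Real.cos_pi_div_two, Real.sin_pi_div_two] at t2 t3
  rw [dist_comm, dist_eq_norm, dist_eq_norm] at hd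
  rw [dist_comm, dist_eq_norm, dist_comm c'', dist_eq_norm] at hd2
  rw [norm_sub_rev c'' e'', ← hd2] at t3 t4
  rw [← hd] at t4
  have p0 : 0 < ‖c' - a‖ := norm_pos_iff.mpr (sub_ne_zero.mpr n0.symm)
  have p1 : 0 < ‖e' - c'‖ := norm_pos_iff.mpr (sub_ne_zero.mpr n1.symm)
  have p2 : 0 < ‖e'' - e'‖ := norm_pos_iff.mpr (sub_ne_zero.mpr n2.symm)
  have d0 : c' - a ≠ 0 := sub_ne_zero.mpr n0.symm
  obtain ⟨s, hs⟩ : ∃ s, s = ‖e' - c'‖ / ‖c' - a‖ := ⟨_, rfl⟩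
  have s0 : 0 < s := by rw [hs]; positivity
  have hs' : ‖c' - a‖ / ‖e' - c'‖ = s⁻¹ := by rw [hs, inv_div]
  have t3' : c'' - e'' = -(e' - c') := by
    have q1 : (‖e' - c'‖ : ℂ) ≠ 0 := by exact_mod_cast p1.ne'
    have q2 : (‖e'' - e'‖ : ℂ) ≠ 0 := by exact_mod_cast p2.ne'
    push_cast at t2 t3
    generalize (‖e' - c'‖ : ℂ) = x at *
    generalize (‖e'' - e'‖ : ℂ) = y at *
    rw [t3, t2]
    field_simp
    linear_combination Complex.I_mul_I
  rw [hs', t3'] at t4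
  rw [← hs] at t1
  have sc : (s : ℂ) ≠ 0 := by exact_mod_cast s0.ne'
  have r3 : (√3 : ℝ) * √3 = 3 := Real.mul_self_sqrt (by norm_num)
  have r3p : 0 < √3 := by positivity
  have r3c : (√3 : ℂ) * √3 = 3 := by exact_mod_cast r3
  have I2 := Complex.I_mul_I
  generalize hdd : c' - a = d at *
  have E1 : e' - a = d * ((⟨1 - s / 2, s * √3 / 2⟩ : ℝ × ℝ).1 + (s * √3 / 2 : ℝ) * Complex.I) := by
    push_cast at t1 ⊢
    linear_combination t1 + hdd
  have E2 : a - c'' = d * ((1 / 2 : ℝ) + (√3 / 2 : ℝ) * Complex.I) := by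
    rw [t4, t1]
    push_cast
    field_simp
    linear_combination (-(√3 * √3 : ℂ)) * I2 + r3c
  have E3 : e'' - e' = d * ((-3 / 2 : ℝ) + (-√3 / 2 : ℝ) * Complex.I) := by
    push_cast at E2 ⊢
    linear_combination -t3' - E2 - hdd
  simp only at E1
  have hs2 : 1 / 2 < s := by
    by_contra hcon
    push Not at hcon
    have : a + ((1 - 2 * s : ℝ) : ℂ) * d ∈ segment ℝ a c' ∩ segment ℝ e' e'' := by
      constructor
      · refine ⟨2 * s, 1 - 2 * s, by linarith, by linarith, by ring, ?_⟩
        simp only [Complex.real_smul]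
        push_cast
        linear_combination (1 - 2 * s : ℂ) * hdd
      · refine ⟨1 - s, s, by linarith, by linarith, by ring, ?_⟩
        simp only [Complex.real_smul]
        push_cast at E1 E3 ⊢
        linear_combination E1 + s * E3
    rw [hdis] at this
    exact this
  have E1' : a - e' = d * -((1 - s / 2 : ℝ) + (s * √3 / 2 : ℝ) * Complex.I) := by
    linear_combination -E1
  have E3' : e' - e'' = d * ((3 / 2 : ℝ) + (√3 / 2 : ℝ) * Complex.I) := by
    push_cast at E3 ⊢
    linear_combination -E3
  have E4 : a - e'' = d * ((1 / 2 + s / 2 : ℝ) + (√3 / 2 - s * √3 / 2 : ℝ) * Complex.I) := by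
    push_cast at E3 E1 ⊢
    linear_combination -E3 - E1
  obtain ⟨z, hz⟩ : ∃ z : ℂ, z = (1 - s / 2 : ℝ) + (s * √3 / 2 : ℝ) * Complex.I := ⟨_, rfl⟩
  obtain ⟨w, hw⟩ : ∃ w : ℂ, w = z * ((√3 / 2 : ℝ) + (-1 / 2 : ℝ) * Complex.I) := ⟨_, rfl⟩
  have zim : 0 < z.im := by
    rw [hz]; simp; positivity
  have wim : 0 < w.im := by
    rw [hw, hz]; simp; nlinarith
  have z0 : z ≠ 0 := by rintro rfl; simp at zim
  have w0 : w ≠ 0 := by rintro rfl; simp at wim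
  have a1 : φ = z.arg := by
    rw [hφ, EuclideanGeometry.angle, vsub_eq_sub, vsub_eq_sub, hdd, E1, ← hz]
    have := Complex.angle_mul_left d0 1 z
    rw [mul_one] at this
    rw [this, Complex.angle_one_left z0, abs_of_nonneg (Complex.arg_nonneg_iff.mpr zim.le)]
  have a2 : α = w.arg := by
    rw [hα, EuclideanGeometry.angle, vsub_eq_sub, vsub_eq_sub, E1', E3, ← hz,
      Complex.angle_mul_left d0, Complex.angle_eq_abs_arg (by simpa using z0)
        (by intro h; have := congrArg Complex.re h; simp at this)]
    have : -z / ((-3 / 2 : ℝ) + (-√3 / 2 : ℝ) * Complex.I) = ((√3)⁻¹ : ℝ) * w := by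
      rw [div_eq_iff (by intro h; have := congrArg Complex.re h; simp at this), hw]
      have : (√3 : ℂ) ≠ 0 := by exact_mod_cast r3p.ne'
      push_cast
      field_simp
      linear_combination (-√3 : ℂ) * I2 + Complex.I * r3c
    rw [this, Complex.arg_real_mul _ (by positivity),
      abs_of_nonneg (Complex.arg_nonneg_iff.mpr wim.le)]
  have a3 : β = w.arg := by
    rw [hβ, EuclideanGeometry.angle, vsub_eq_sub, vsub_eq_sub, E4, E3',
      Complex.angle_mul_left d0, Complex.angle_eq_abs_arg
        (by intro h; have := congrArg Complex.re h; simp at this; linarith)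
        (by intro h; have := congrArg Complex.re h; simp at this)]
    have : ((1 / 2 + s / 2 : ℝ) + (√3 / 2 - s * √3 / 2 : ℝ) * Complex.I) /
        ((3 / 2 : ℝ) + (√3 / 2 : ℝ) * Complex.I) = ((√3)⁻¹ : ℝ) * (starRingEnd ℂ) w := by
      rw [div_eq_iff (by intro h; have := congrArg Complex.re h; simp at this), hw, hz]
      have : (√3 : ℂ) ≠ 0 := by exact_mod_cast r3p.ne'
      simp only [map_mul, map_add, Complex.conj_ofReal, Complex.conj_I]
      apply Complex.ext
      · simp; field_simp; simp only [pow_two, r3]; ring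
      · simp; field_simp; nlinarith
    have habs : |((starRingEnd ℂ) w).arg| = |w.arg| := by
      rw [Complex.arg_conj]
      split_ifs with hpi
      · rw [hpi]
      · exact abs_neg _
    rw [this, Complex.arg_real_mul _ (by positivity), habs,
      abs_of_nonneg (Complex.arg_nonneg_iff.mpr wim.le)]
  have a4 : w.arg = z.arg - π / 6 := by
    have hp := Real.pi_pos
    have g0 : 0 ≤ z.arg := Complex.arg_nonneg_iff.mpr zim.le
    have g1 := Complex.arg_le_pi z
    have := Complex.arg_mul_cos_add_sin_mul_I (norm_pos_iff.mpr z0) (θ := z.arg - π / 6)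
      ⟨by linarith, by linarith⟩
    rw [← this]
    congr 1
    rw [hw]
    conv_lhs => rw [← Complex.norm_mul_cos_add_sin_mul_I z]
    rw [← Complex.ofReal_cos, ← Complex.ofReal_sin, ← Complex.ofReal_cos, ← Complex.ofReal_sin,
      Real.cos_sub, Real.sin_sub, Real.cos_pi_div_six, Real.sin_pi_div_six]
    push_cast
    linear_combination (-(‖z‖ : ℂ) * Complex.sin z.arg / 2) * I2
  exact ⟨by rw [a2, a3], by rw [a2, a1, a4]⟩
end
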